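/- arXiv:2110.08891 — 6 statements merged into one kernel-verified Lean document; each statement's English description precedes it below -/
import Mathlib

section
/- Let R be a commutative ring, r, s ∈ R, and C a cochain complex of R-modules indexed by ℤ such that multiplication by r and multiplication by r·s are each injective on every C^n. Fix i ∈ ℤ. Note that multiplication by s maps the (rs)-torsion submodule {x ∈ H^{i+1}(C) : (rs)·x = 0} into the r-torsion submodule {x ∈ H^{i+1}(C) : r·x = 0}. If this multiplication-by-s map between these two submodules of H^{i+1}(C) is surjective, then the map H^i(C/(rs)C) → H^i(C/rC) induced by the levelwise quotient C/(rs)C → C/rC is surjective. -/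
/-!
Statement 1: if multiplication by `s` from the `(rs)`-torsion of `H^{i+1}(C)` to the
`r`-torsion of `H^{i+1}(C)` is surjective, then the natural map
`H^i(C/(rs)C) → H^i(C/rC)` is surjective.

Degrees are indexed by a base integer `j`, with `i = j + 1`.
-/

section Setup

variable {R : Type} [CommRing R]

/-- The submodule `r·M` of `r`-multiples of a module `M`. -/
def rMul (r : R) (M : Type) [AddCommGroup M] [Module R M] : Submodule R M :=
  LinearMap.range (r • (LinearMap.id : M →ₗ[R] M))

variable (C : ℤ → Type) [∀ n, AddCommGroup (C n)] [∀ n, Module R (C n)]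
variable (d : ∀ n : ℤ, C n →ₗ[R] C (n + 1)) (r s : R)

/-- The components of the quotient complex `C/rC`. -/
abbrev QuotCx (n : ℤ) : Type := C n ⧸ rMul r (C n)

/-- The differential of the quotient complex `C/rC`. -/
def dQ (n : ℤ) : QuotCx C r n →ₗ[R] QuotCx C r (n + 1) :=
  Submodule.mapQ _ _ (d n) (by
    intro x hx
    obtain ⟨y, rfl⟩ := LinearMap.mem_range.mp hx
    exact Submodule.mem_comap.mpr (LinearMap.mem_range.mpr ⟨d n y, by simp⟩))

/-- The cohomology of a `ℤ`-indexed cochain complex in degree `n + 1`. -/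
abbrev Hcoh (X : ℤ → Type) [∀ n, AddCommGroup (X n)] [∀ n, Module R (X n)]
    (D : ∀ n : ℤ, X n →ₗ[R] X (n + 1)) (n : ℤ) : Type :=
  LinearMap.ker (D (n + 1)) ⧸
    Submodule.comap (LinearMap.ker (D (n + 1))).subtype (LinearMap.range (D n))

/-- The natural levelwise quotient map `C/(rs)C → C/rC`. -/
def redMap (n : ℤ) : QuotCx C (r * s) n →ₗ[R] QuotCx C r n :=
  Submodule.mapQ _ _ LinearMap.id (by
    intro x hx
    obtain ⟨y, rfl⟩ := LinearMap.mem_range.mp hx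
    exact Submodule.mem_comap.mpr (LinearMap.mem_range.mpr ⟨s • y, by
      simp [smul_smul, mul_comm]⟩))

/-- The levelwise quotient `C/(rs)C → C/rC` maps cocycles to cocycles. -/
def redKer (n : ℤ) (x : LinearMap.ker (dQ C d (r * s) (n + 1))) :
    LinearMap.ker (dQ C d r (n + 1)) :=
  ⟨redMap C r s (n + 1) x.1, by
    obtain ⟨y, hy⟩ := Submodule.Quotient.mk_surjective _ x.1
    have hx : dQ C d (r * s) (n + 1) x.1 = 0 := LinearMap.mem_ker.mp x.2
    rw [← hy] at hx
    rw [LinearMap.mem_ker, ← hy]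
    have h1 : redMap C r s (n + 1) (Submodule.Quotient.mk y) = Submodule.Quotient.mk y := by
      show Submodule.mapQ _ _ _ _ _ = _
      rw [Submodule.mapQ_apply, LinearMap.id_apply]
    have h2 : dQ C d (r * s) (n + 1) (Submodule.Quotient.mk y) =
        Submodule.Quotient.mk (d (n + 1) y) := by
      show Submodule.mapQ _ _ _ _ _ = _
      rw [Submodule.mapQ_apply]
    have h3 : dQ C d r (n + 1) (Submodule.Quotient.mk y) =
        Submodule.Quotient.mk (d (n + 1) y) := by
      show Submodule.mapQ _ _ _ _ _ = _
      rw [Submodule.mapQ_apply]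
    rw [h1, h3]
    rw [h2, Submodule.Quotient.mk_eq_zero] at hx
    obtain ⟨w, hw⟩ := LinearMap.mem_range.mp hx
    rw [Submodule.Quotient.mk_eq_zero]
    refine LinearMap.mem_range.mpr ⟨s • w, ?_⟩
    simp only [LinearMap.smul_apply, LinearMap.id_apply] at hw ⊢
    rw [smul_smul, ← hw]⟩

end Setup

section QuotientComplex

variable {R : Type} [CommRing R]

theorem mem_rMul {M : Type} [AddCommGroup M] [Module R M] {r : R} {x : M} :
    x ∈ rMul r M ↔ ∃ y, r • y = x :=
  Iff.rfl

variable (C : ℤ → Type) [∀ n, AddCommGroup (C n)] [∀ n, Module R (C n)]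
variable (d : ∀ n : ℤ, C n →ₗ[R] C (n + 1)) (r s : R)

theorem dQ_mk (n : ℤ) (x : C n) :
    dQ C d r n (Submodule.Quotient.mk x) = Submodule.Quotient.mk (d n x) :=
  rfl

theorem redMap_dQ (n : ℤ) (x : QuotCx C (r * s) n) :
    redMap C r s (n + 1) (dQ C d (r * s) n x) = dQ C d r n (redMap C r s n x) := by
  obtain ⟨y, rfl⟩ := Submodule.Quotient.mk_surjective _ x
  rfl

/-- The map induced on cocycles by `C/(rs)C → C/rC`, as a linear map. -/
def redKerLinear (n : ℤ) :
    LinearMap.ker (dQ C d (r * s) (n + 1)) →ₗ[R] LinearMap.ker (dQ C d r (n + 1)) where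
  toFun := redKer C d r s n
  map_add' x y := Subtype.ext (map_add (redMap C r s (n + 1)) x.1 y.1)
  map_smul' a x := Subtype.ext (map_smul (redMap C r s (n + 1)) a x.1)

/-- The map induced on cohomology by `C/(rs)C → C/rC`. -/
def redCoh (n : ℤ) :
    Hcoh (QuotCx C (r * s)) (dQ C d (r * s)) n →ₗ[R] Hcoh (QuotCx C r) (dQ C d r) n :=
  Submodule.mapQ _ _ (redKerLinear C d r s n) (by
    rintro x ⟨w, hw⟩
    exact ⟨redMap C r s n w, (redMap_dQ C d r s n w).symm.trans
      (congrArg (redMap C r s (n + 1)) hw)⟩)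

theorem redCoh_mk (n : ℤ) (x : LinearMap.ker (dQ C d (r * s) (n + 1))) :
    redCoh C d r s n (Submodule.Quotient.mk x) = Submodule.Quotient.mk (redKer C d r s n x) :=
  rfl

variable {C d r s}

/-- If `d y = r • z` then `z` is a cocycle whose class is `r`-torsion; dividing this class by `s`
amounts to changing `y` by a multiple of `r` so that `d y` becomes a multiple of `r * s`. -/
theorem exists_d_add_smul_eq_mul_smul
    (hdd : ∀ (n : ℤ) (x : C n), d (n + 1) (d n x) = 0)
    (hr : ∀ (n : ℤ) (x : C n), r • x = 0 → x = 0) {n : ℤ}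
    (hsurj : ∀ y ∈ Submodule.torsionBy R (Hcoh C d n) r, ∃ x : Hcoh C d n, s • x = y)
    {y : C n} {z : C (n + 1)} (hz : r • z = d n y) :
    ∃ (u : C n) (w : C (n + 1)), (r * s) • w = d n (y + r • u) := by
  have hdz : d (n + 1) z = 0 := hr _ _ (by rw [← map_smul, hz, hdd])
  obtain ⟨x, hx⟩ := hsurj (Submodule.Quotient.mk ⟨z, hdz⟩) (by
    rw [Submodule.mem_torsionBy_iff, ← Submodule.Quotient.mk_smul, Submodule.Quotient.mk_eq_zero]
    exact ⟨y, hz.symm⟩)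
  obtain ⟨w, rfl⟩ := Submodule.Quotient.mk_surjective _ x
  rw [← Submodule.Quotient.mk_smul, Submodule.Quotient.eq] at hx
  obtain ⟨u, hu⟩ := hx
  have hu' : d n u = s • (w : C (n + 1)) - z := hu
  refine ⟨u, w, ?_⟩
  rw [map_add, map_smul, hu', ← hz, smul_sub, mul_smul, add_sub_cancel]

end QuotientComplex

/-- Let `R` be a commutative ring, `r, s ∈ R`, and `C` a cochain complex of
`R`-modules on which multiplication by `r` and by `r*s` are injective in every degree.
If multiplication by `s`, viewed as a map from the `(rs)`-torsion submodule of `H^{i+1}(C)`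
to the `r`-torsion submodule of `H^{i+1}(C)`, is surjective, then the map
`H^i(C/(rs)C) → H^i(C/rC)` induced by the levelwise quotient is surjective.
(Here `i = j + 1`.) -/
theorem surjectivity_of_truncation_map_of_torsion_surjective
    {R : Type} [CommRing R]
    (C : ℤ → Type) [∀ n, AddCommGroup (C n)] [∀ n, Module R (C n)]
    (d : ∀ n : ℤ, C n →ₗ[R] C (n + 1))
    (hdd : ∀ (n : ℤ) (x : C n), d (n + 1) (d n x) = 0)
    (r s : R)
    (hr : ∀ (n : ℤ) (x : C n), r • x = 0 → x = 0)
    (hrs : ∀ (n : ℤ) (x : C n), (r * s) • x = 0 → x = 0)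
    (j : ℤ)
    (hsurj : ∀ y ∈ Submodule.torsionBy R (Hcoh C d (j + 1)) r,
      ∃ x ∈ Submodule.torsionBy R (Hcoh C d (j + 1)) (r * s), s • x = y) :
    ∃ g : Hcoh (QuotCx C (r * s)) (dQ C d (r * s)) j →ₗ[R] Hcoh (QuotCx C r) (dQ C d r) j,
      (∀ x : LinearMap.ker (dQ C d (r * s) (j + 1)),
          g (Submodule.Quotient.mk x) = Submodule.Quotient.mk (redKer C d r s j x)) ∧
      Function.Surjective g := by
  refine ⟨redCoh C d r s j, redCoh_mk C d r s j, fun q => ?_⟩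
  obtain ⟨⟨c, hc⟩, rfl⟩ := Submodule.Quotient.mk_surjective _ q
  obtain ⟨y, rfl⟩ := Submodule.Quotient.mk_surjective _ c
  obtain ⟨z, hz⟩ := mem_rMul.mp ((Submodule.Quotient.mk_eq_zero _).mp hc)
  obtain ⟨u, w, huw⟩ := exists_d_add_smul_eq_mul_smul hdd hr
    (fun t ht => (hsurj t ht).imp fun _ h => h.2) hz
  refine ⟨Submodule.Quotient.mk ⟨Submodule.Quotient.mk (y + r • u), ?_⟩, ?_⟩
  · rw [LinearMap.mem_ker, dQ_mk, Submodule.Quotient.mk_eq_zero]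
    exact mem_rMul.mpr ⟨w, huw⟩
  · rw [redCoh_mk]
    congr 1
    refine Subtype.ext ((Submodule.Quotient.eq _).mpr (mem_rMul.mpr ⟨u, ?_⟩))
    exact (add_sub_cancel_left y (r • u)).symm
end

section
/- Choose positive real numbers a, b, c with a > c and b > c. In ℝ³ set U := (−b, ∞) × (−a, a) × (−a, a), l := {(x, 0, 0) : x ≥ 0}, and V := (−c, ∞) × (−c, c) × (−c, c). Then there exists a diffeomorphism G from the open set U ∖ l onto U (a smooth bijection whose inverse is smooth) such that: (1) G preserves the third coordinate, i.e. the third component of G(x, y, z) equals z for all (x, y, z) ∈ U ∖ l; and (2) G is the identity outside V, i.e. G(p) = p for all p ∈ U ∖ V. -/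
open Set

/-- The box `(-b, ∞) × (-a, a) × (-a, a)` in `ℝ³`. -/
def U3 (a b : ℝ) : Set (ℝ × ℝ × ℝ) := Ioi (-b) ×ˢ (Ioo (-a) a ×ˢ Ioo (-a) a)

/-- The ray `l = {(x, 0, 0) : x ≥ 0}` in `ℝ³`. -/
def ray3 : Set (ℝ × ℝ × ℝ) := {p | 0 ≤ p.1 ∧ p.2.1 = 0 ∧ p.2.2 = 0}

/-- The box `(-c, ∞) × (-c, c) × (-c, c)` in `ℝ³`. -/
def V3 (c : ℝ) : Set (ℝ × ℝ × ℝ) := Ioi (-c) ×ˢ (Ioo (-c) c ×ˢ Ioo (-c) c)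

open Filter Topology

/-- An injective `C^n` map on an open subset of a finite-dimensional space whose derivative is
everywhere injective has `C^n` inverse. -/
theorem contDiffAt_leftInverse_of_injOn {E : Type*} [NormedAddCommGroup E] [NormedSpace ℝ E]
    [FiniteDimensional ℝ E] {n : WithTop ℕ∞} (hn : n ≠ 0) {W : Set E} (hW : IsOpen W)
    {f g : E → E} (hf : ContDiffOn ℝ n f W) (hgf : ∀ p ∈ W, g (f p) = p)
    (hinj : ∀ p ∈ W, ∀ v, fderiv ℝ f p v = 0 → v = 0) {p : E} (hp : p ∈ W) :
    ContDiffAt ℝ n g (f p) := by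
  have : CompleteSpace E := FiniteDimensional.complete ℝ E
  have hfp : ContDiffAt ℝ n f p := hf.contDiffAt (hW.mem_nhds hp)
  have hker : Function.Injective (fderiv ℝ f p : E →ₗ[ℝ] E) :=
    (injective_iff_map_eq_zero _).2 (hinj p hp)
  let e : E ≃L[ℝ] E := (LinearEquiv.ofInjectiveEndo _ hker).toContinuousLinearEquiv
  have he : (e : E →L[ℝ] E) = fderiv ℝ f p := by
    ext v
    rfl
  have hd : HasFDerivAt f (e : E →L[ℝ] E) p := by
    rw [he]
    exact (hfp.differentiableAt hn).hasFDerivAt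
  refine (hfp.to_localInverse hd hn).congr_of_eventuallyEq ?_
  refine (hfp.hasStrictFDerivAt' hd hn).localInverse_unique ?_
  filter_upwards [hW.mem_nhds hp] with x hx using hgf x hx

theorem HasDerivAt.one_le_of_eventually_expanding {f : ℝ → ℝ} {f' x : ℝ} (hf : HasDerivAt f f' x)
    (h : ∀ᶠ y in 𝓝 x, (x ≤ y → y - x ≤ f y - f x) ∧ (y ≤ x → x - y ≤ f x - f y)) :
    1 ≤ f' := by
  refine ge_of_tendsto hf.tendsto_slope ?_
  filter_upwards [h.filter_mono nhdsWithin_le_nhds, self_mem_nhdsWithin] with y hy hne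
  rw [slope_def_field]
  rcases lt_or_gt_of_ne (show y ≠ x from hne) with hlt | hlt
  · rw [← neg_div_neg_eq, le_div_iff₀ (by linarith)]
    linarith [hy.2 hlt.le]
  · rw [le_div_iff₀ (by linarith)]
    linarith [hy.1 hlt.le]

theorem isOpen_compl_ray3 : IsOpen (ray3ᶜ) := by
  rw [isOpen_compl_iff]
  exact (isClosed_le continuous_const continuous_fst).inter
    ((isClosed_eq (by fun_prop) continuous_const).inter
      (isClosed_eq (by fun_prop) continuous_const))

/-- The function `‖p‖ - p.1`, which vanishes exactly on `ray3`. -/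
noncomputable def rayGap (p : ℝ × ℝ × ℝ) : ℝ := √(p.1 ^ 2 + p.2.1 ^ 2 + p.2.2 ^ 2) - p.1

theorem sq_sum_pos {p : ℝ × ℝ × ℝ} (hp : p ∉ ray3) : 0 < p.1 ^ 2 + p.2.1 ^ 2 + p.2.2 ^ 2 := by
  by_contra! h
  have h1 : p.1 = 0 := by nlinarith [sq_nonneg p.1, sq_nonneg p.2.1, sq_nonneg p.2.2]
  have h2 : p.2.1 = 0 := by nlinarith [sq_nonneg p.1, sq_nonneg p.2.1, sq_nonneg p.2.2]
  have h3 : p.2.2 = 0 := by nlinarith [sq_nonneg p.1, sq_nonneg p.2.1, sq_nonneg p.2.2]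
  exact hp ⟨h1.ge, h2, h3⟩

theorem rayGap_pos {p : ℝ × ℝ × ℝ} (hp : p ∉ ray3) : 0 < rayGap p := by
  rw [rayGap, sub_pos]
  rcases lt_or_ge p.1 0 with h | h
  · exact h.trans_le (Real.sqrt_nonneg _)
  · refine Real.lt_sqrt_of_sq_lt ?_
    by_contra! hs
    have h2 : p.2.1 = 0 := by nlinarith [sq_nonneg p.2.1, sq_nonneg p.2.2]
    have h3 : p.2.2 = 0 := by nlinarith [sq_nonneg p.2.1, sq_nonneg p.2.2]
    exact hp ⟨h, h2, h3⟩

theorem rayGap_antitone {x x' : ℝ} (w : ℝ × ℝ) (h : x ≤ x') : rayGap (x', w) ≤ rayGap (x, w) := by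
  have hx : x ≤ √(x ^ 2 + w.1 ^ 2 + w.2 ^ 2) := by
    refine Real.le_sqrt_of_sq_le ?_
    nlinarith [sq_nonneg w.1, sq_nonneg w.2]
  have hs : √(x ^ 2 + w.1 ^ 2 + w.2 ^ 2) ^ 2 = x ^ 2 + w.1 ^ 2 + w.2 ^ 2 :=
    Real.sq_sqrt (by positivity)
  have key : √(x' ^ 2 + w.1 ^ 2 + w.2 ^ 2) ≤ √(x ^ 2 + w.1 ^ 2 + w.2 ^ 2) + (x' - x) := by
    refine Real.sqrt_le_iff.2 ⟨add_nonneg (Real.sqrt_nonneg _) (by linarith), ?_⟩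
    nlinarith [mul_nonneg (sub_nonneg.2 hx) (sub_nonneg.2 h)]
  simp only [rayGap]
  linarith

/-- The amount by which a point is pushed along the first axis. -/
noncomputable def slideShift (c : ℝ) (p : ℝ × ℝ × ℝ) : ℝ :=
  expNegInvGlue (p.1 + c) * expNegInvGlue (c ^ 2 - p.2.1 ^ 2 - p.2.2 ^ 2) / rayGap p

/-- The map pushing each point off the ray to infinity along the first axis. -/
noncomputable def slide (c : ℝ) (p : ℝ × ℝ × ℝ) : ℝ × ℝ × ℝ := (p.1 + slideShift c p, p.2)

theorem slideShift_nonneg (c : ℝ) {p : ℝ × ℝ × ℝ} (hp : p ∉ ray3) : 0 ≤ slideShift c p :=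
  div_nonneg (mul_nonneg (expNegInvGlue.nonneg _) (expNegInvGlue.nonneg _)) (rayGap_pos hp).le

theorem slideShift_mono (c : ℝ) {x x' : ℝ} {w : ℝ × ℝ} (hx' : (x', w) ∉ ray3) (h : x ≤ x') :
    slideShift c (x, w) ≤ slideShift c (x', w) :=
  div_le_div₀ (mul_nonneg (expNegInvGlue.nonneg _) (expNegInvGlue.nonneg _))
    (mul_le_mul_of_nonneg_right (expNegInvGlue.monotone (by dsimp only; linarith))
      (expNegInvGlue.nonneg _)) (rayGap_pos hx') (rayGap_antitone w h)

theorem slideShift_eq_zero_of_le {c : ℝ} {p : ℝ × ℝ × ℝ} (hp : p.1 ≤ -c) :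
    slideShift c p = 0 := by
  simp [slideShift, expNegInvGlue.zero_of_nonpos (show p.1 + c ≤ 0 by linarith)]

theorem slideShift_eq_zero {c : ℝ} (hc : 0 < c) {p : ℝ × ℝ × ℝ} (hp : p ∉ V3 c) :
    slideShift c p = 0 := by
  by_cases hx : p.1 ≤ -c
  · exact slideShift_eq_zero_of_le hx
  have hs : c ^ 2 - p.2.1 ^ 2 - p.2.2 ^ 2 ≤ 0 := by
    by_contra! hs
    refine hp ⟨not_le.1 hx, abs_lt.1 (abs_lt_of_sq_lt_sq ?_ hc.le),
      abs_lt.1 (abs_lt_of_sq_lt_sq ?_ hc.le)⟩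
    · nlinarith [sq_nonneg p.2.2]
    · nlinarith [sq_nonneg p.2.1]
  simp [slideShift, expNegInvGlue.zero_of_nonpos hs]

theorem contDiffOn_slideShift (c : ℝ) : ContDiffOn ℝ (⊤ : ℕ∞) (slideShift c) (ray3ᶜ) := by
  intro p hp
  refine ContDiffAt.contDiffWithinAt (ContDiffAt.div (ContDiffAt.mul ?_ ?_) ?_ (rayGap_pos hp).ne')
  · exact (expNegInvGlue.contDiff.comp (by fun_prop)).contDiffAt
  · exact (expNegInvGlue.contDiff.comp (by fun_prop)).contDiffAt
  · have hsq : ContDiffAt ℝ (⊤ : ℕ∞)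
        (fun q : ℝ × ℝ × ℝ => q.1 ^ 2 + q.2.1 ^ 2 + q.2.2 ^ 2) p := by fun_prop
    exact (hsq.sqrt (sq_sum_pos hp).ne').sub contDiffAt_fst

theorem contDiffOn_slide (c : ℝ) : ContDiffOn ℝ (⊤ : ℕ∞) (slide c) (ray3ᶜ) :=
  (contDiff_fst.contDiffOn.add (contDiffOn_slideShift c)).prodMk contDiff_snd.contDiffOn

theorem slide_expanding (c : ℝ) {x x' : ℝ} {w : ℝ × ℝ} (hx' : (x', w) ∉ ray3) (h : x ≤ x') :
    x' - x ≤ (slide c (x', w)).1 - (slide c (x, w)).1 := by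
  have := slideShift_mono c hx' h
  simp only [slide]
  linarith

theorem slide_injOn (c : ℝ) : InjOn (slide c) (ray3ᶜ) := by
  rintro ⟨x, w⟩ hp ⟨x', w'⟩ hq h
  obtain rfl : w = w' := congrArg Prod.snd h
  have h1 : (slide c (x, w)).1 = (slide c (x', w)).1 := congrArg Prod.fst h
  obtain rfl : x = x' := by
    rcases le_total x x' with hle | hle
    · linarith [slide_expanding c hq hle]
    · linarith [slide_expanding c hp hle]
  rfl

theorem fderiv_slide_ker (c : ℝ) {p : ℝ × ℝ × ℝ} (hp : p ∈ ray3ᶜ) (v : ℝ × ℝ × ℝ)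
    (hv : fderiv ℝ (slide c) p v = 0) : v = 0 := by
  have hW : ray3ᶜ ∈ 𝓝 p := isOpen_compl_ray3.mem_nhds hp
  have hd : HasFDerivAt (slide c) (fderiv ℝ (slide c) p) p :=
    (((contDiffOn_slide c).contDiffAt hW).differentiableAt (by simp)).hasFDerivAt
  have hsnd : fderiv ℝ (slide c) p v = 0 → v.2 = 0 := by
    intro h
    have := hd.snd.unique (hasFDerivAt_snd (𝕜 := ℝ) (p := p))
    simpa [h] using (DFunLike.congr_fun this v).symm
  obtain ⟨t, w⟩ := v
  obtain rfl : w = 0 := hsnd hv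
  have hline : HasDerivAt (fun x : ℝ => (x, p.2)) ((1 : ℝ), (0 : ℝ × ℝ)) p.1 :=
    (hasDerivAt_id p.1).prodMk (hasDerivAt_const p.1 p.2)
  have hx : HasDerivAt (fun x : ℝ => (slide c (x, p.2)).1)
      (fderiv ℝ (slide c) p ((1 : ℝ), (0 : ℝ × ℝ))).1 p.1 := by
    have hd1 := hd.fst
    exact hd1.comp_hasDerivAt p.1 hline
  have h1 := hx.one_le_of_eventually_expanding <| by
    filter_upwards [hline.continuousAt.eventually hW] with y hy
    exact ⟨fun h => slide_expanding c hy h, fun h => slide_expanding c hp h⟩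
  have ht : ((t, 0) : ℝ × ℝ × ℝ) = t • ((1 : ℝ), (0 : ℝ × ℝ)) := by simp
  rw [ht, map_smul] at hv
  have hv1 := congrArg Prod.fst hv
  simp only [Prod.smul_fst, Prod.fst_zero, smul_eq_mul] at hv1
  have : t = 0 := (mul_eq_zero.1 hv1).resolve_right (by linarith)
  simp [this]

/-- Each point lies below the image of some point on the same line which can be joined to `-∞`
without meeting the ray. -/
theorem exists_le_slide {c : ℝ} (hc : 0 < c) (t : ℝ) (w : ℝ × ℝ) :
    ∃ x, (∀ y ≤ x, (y, w) ∉ ray3) ∧ t ≤ (slide c (x, w)).1 := by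
  by_cases hw : w = 0
  · subst hw
    have hK : 0 < expNegInvGlue (c / 2) * expNegInvGlue (c ^ 2) :=
      mul_pos (expNegInvGlue.pos_of_pos (by positivity)) (expNegInvGlue.pos_of_pos (by positivity))
    set K := expNegInvGlue (c / 2) * expNegInvGlue (c ^ 2)
    obtain ⟨ε, hε, hε1, hε2⟩ : ∃ ε > 0, ε ≤ c / 2 ∧ ε ≤ K / (2 * (|t| + c)) :=
      ⟨min (c / 2) (K / (2 * (|t| + c))), by positivity, min_le_left _ _, min_le_right _ _⟩
    have hray : ∀ y ≤ -ε, ((y, 0) : ℝ × ℝ × ℝ) ∉ ray3 := fun y hy h => by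
      have : 0 ≤ y := h.1
      linarith
    refine ⟨-ε, hray, ?_⟩
    have hgap : rayGap (-ε, 0) = 2 * ε := by
      simp [rayGap, Real.sqrt_sq hε.le]
      ring
    have hshift : |t| + c ≤ slideShift c (-ε, 0) := by
      rw [slideShift, hgap, le_div_iff₀ (by positivity)]
      have h1 : K ≤ expNegInvGlue (-ε + c) * expNegInvGlue (c ^ 2 - 0 ^ 2 - 0 ^ 2) := by
        have : c ^ 2 - 0 ^ 2 - 0 ^ 2 = c ^ 2 := by ring
        rw [this]
        exact mul_le_mul_of_nonneg_right (expNegInvGlue.monotone (by linarith))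
          (expNegInvGlue.nonneg _)
      rw [le_div_iff₀ (by positivity)] at hε2
      refine le_trans ?_ h1
      linarith
    simp only [slide]
    linarith [le_abs_self t]
  · have hray : ∀ y, (y, w) ∉ ray3 := fun y h => hw (Prod.ext h.2.1 h.2.2)
    exact ⟨t, fun y _ => hray y, le_add_of_nonneg_right (slideShift_nonneg c (hray t))⟩

theorem slide_surjOn {c : ℝ} (hc : 0 < c) : SurjOn (slide c) (ray3ᶜ) univ := by
  rintro ⟨t, w⟩ -
  obtain ⟨x, hx, htx⟩ := exists_le_slide hc t w
  set x₀ := min (min x t) (-c)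
  have hx₀x : x₀ ≤ x := (min_le_left _ _).trans (min_le_left _ _)
  have hx₀t : (slide c (x₀, w)).1 ≤ t := by
    have : slideShift c (x₀, w) = 0 := slideShift_eq_zero_of_le (min_le_right _ _)
    simp only [slide, this, add_zero]
    exact (min_le_left _ _).trans (min_le_right _ _)
  have hcont : ContinuousOn (fun y : ℝ => (slide c (y, w)).1) (Icc x₀ x) :=
    continuous_fst.comp_continuousOn <| (contDiffOn_slide c).continuousOn.comp
      (by fun_prop) (fun y hy => hx y hy.2)
  obtain ⟨y, hy, hyt⟩ := intermediate_value_Icc hx₀x hcont ⟨hx₀t, htx⟩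
  exact ⟨(y, w), hx y hy.2, Prod.ext hyt rfl⟩

/-- For positive reals `a, b, c` with `a > c`, `b > c`, there is a
diffeomorphism `G` from `U ∖ l` onto `U` (smooth bijection with smooth inverse `G'`)
which preserves the third coordinate and is the identity outside `V`. -/
theorem exists_sliding_diffeomorphism
    (a b c : ℝ) (ha : 0 < a) (hb : 0 < b) (hc : 0 < c) (hca : c < a) (hcb : c < b) :
    ∃ G G' : ℝ × ℝ × ℝ → ℝ × ℝ × ℝ,
      ContDiffOn ℝ (⊤ : ℕ∞) G (U3 a b \ ray3) ∧
      ContDiffOn ℝ (⊤ : ℕ∞) G' (U3 a b) ∧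
      Set.MapsTo G (U3 a b \ ray3) (U3 a b) ∧
      Set.MapsTo G' (U3 a b) (U3 a b \ ray3) ∧
      (∀ p ∈ U3 a b \ ray3, G' (G p) = p) ∧
      (∀ q ∈ U3 a b, G (G' q) = q) ∧
      (∀ p ∈ U3 a b \ ray3, (G p).2.2 = p.2.2) ∧
      (∀ p ∈ U3 a b \ V3 c, G p = p) := by
  have hbij : ∀ q, ∃ p ∈ ray3ᶜ, slide c p = q := fun q => slide_surjOn hc (mem_univ q)
  choose G' hG'mem hG' using hbij
  have hleft : ∀ p ∈ ray3ᶜ, G' (slide c p) = p := fun p hp =>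
    slide_injOn c (hG'mem _) hp (hG' _)
  have hsmooth : ∀ q, ContDiffAt ℝ (⊤ : ℕ∞) G' q := fun q => by
    rw [← hG' q]
    exact contDiffAt_leftInverse_of_injOn (by simp) isOpen_compl_ray3 (contDiffOn_slide c) hleft
      (fun p hp v hv => fderiv_slide_ker c hp v hv) (hG'mem q)
  refine ⟨slide c, G', (contDiffOn_slide c).mono fun p hp => hp.2,
    fun q _ => (hsmooth q).contDiffWithinAt, ?_, ?_, fun p hp => hleft p hp.2,
    fun q _ => hG' q, fun p _ => rfl, ?_⟩
  · rintro p ⟨hp, hpr⟩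
    exact ⟨lt_of_lt_of_le hp.1 (le_add_of_nonneg_right (slideShift_nonneg c hpr)), hp.2⟩
  · intro q hq
    have hsnd : (G' q).2 = q.2 := (congrArg Prod.snd (hG' q) :)
    refine ⟨⟨?_, hsnd ▸ hq.2⟩, hG'mem q⟩
    by_contra! hle
    have hle' : (G' q).1 ≤ -b := not_lt.1 hle
    have hfst : (G' q).1 + slideShift c (G' q) = q.1 := (congrArg Prod.fst (hG' q) :)
    rw [slideShift_eq_zero_of_le (by linarith)] at hfst
    have : -b < q.1 := hq.1
    linarith
  · rintro p ⟨-, hp⟩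
    simp [slide, slideShift_eq_zero hc hp]
end

section
/- Let W ⊆ ℝ³ be an open set containing the ray l := {(x, 0, 0) : x ≥ 0}. Then there exist a > 0 and b > 0 and a smooth map F : (−b, ∞) × (−a, a) × (−a, a) → W of the form F(x, y, z) = (F₁(x, y, z), y, z) such that F is injective, the differential of F is invertible at every point (so F is an open embedding onto its image in W), and F(x, 0, 0) = (x, 0, 0) for all x ∈ (−b, ∞). -/
open Set

open Filter Topology

/-- A smooth monotone function on the line that vanishes on `(-∞, 0]` and dominates a prescribed
sequence: it is at least `c n` on `[n + 1, ∞)`. -/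
theorem exists_contDiff_monotone_ge (c : ℕ → ℝ) (hc : ∀ n, 0 ≤ c n) :
    ∃ k : ℝ → ℝ, ContDiff ℝ (⊤ : ℕ∞) k ∧ Monotone k ∧ (∀ x ≤ 0, k x = 0) ∧
      ∀ (n : ℕ) (x : ℝ), n + 1 ≤ x → c n ≤ k x := by
  set S : ℕ → ℝ → ℝ := fun N x ↦ ∑ n ∈ Finset.range N, c n * Real.smoothTransition (x - n) with hS
  have hmono : ∀ N, Monotone (S N) := fun N x y hxy ↦ by
    refine Finset.sum_le_sum fun n _ ↦ mul_le_mul_of_nonneg_left ?_ (hc n)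
    exact Real.smoothTransition.monotone (by linarith)
  have hsmooth : ∀ N, ContDiff ℝ (⊤ : ℕ∞) (S N) := fun N ↦
    ContDiff.sum fun n _ ↦ contDiff_const.mul
      (Real.smoothTransition.contDiff.comp (contDiff_id.sub contDiff_const))
  have heq : ∀ (N : ℕ) (x : ℝ), x ≤ N → S ⌈x⌉₊ x = S N x := fun N x hx ↦ by
    refine Finset.sum_subset (Finset.range_mono (Nat.ceil_le.2 hx)) fun n _ hn ↦ ?_
    have : x ≤ n := Nat.ceil_le.1 (by simpa using hn)
    rw [Real.smoothTransition.zero_of_nonpos (by linarith), mul_zero]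
  refine ⟨fun x ↦ S ⌈x⌉₊ x, contDiff_iff_contDiffAt.2 fun x ↦ ?_, fun x y hxy ↦ ?_,
    fun x hx ↦ ?_, fun n x hx ↦ ?_⟩
  · obtain ⟨N, hN⟩ := exists_nat_gt x
    refine (hsmooth N).contDiffAt.congr_of_eventuallyEq ?_
    filter_upwards [Iio_mem_nhds hN] with y hy using heq N y (le_of_lt hy)
  · have hy := Nat.le_ceil y
    simpa only [heq _ x (hxy.trans hy)] using hmono _ hxy
  · simp [hS, Nat.ceil_eq_zero.2 hx]
  · have hn : n ∈ Finset.range ⌈x⌉₊ := by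
      rw [Finset.mem_range, Nat.lt_ceil]; linarith
    refine le_trans ?_ (Finset.single_le_sum (fun m _ ↦
      mul_nonneg (hc m) (Real.smoothTransition.nonneg (x - m))) hn)
    rw [Real.smoothTransition.one_of_one_le (by linarith), mul_one]

/-- A right inverse of a smooth map `Φ` is smooth with bijective differential, provided it takes
values in an open set on which `Φ` is injective and has bijective differential. -/
theorem contDiffAt_and_bijective_fderiv_of_rightInverse {E : Type*} [NormedAddCommGroup E]
    [NormedSpace ℝ E] [CompleteSpace E] {n : WithTop ℕ∞} (hn : n ≠ 0) {Φ G : E → E} {D : Set E}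
    (hD : IsOpen D) (hinj : InjOn Φ D) (hG : ∀ p, G p ∈ D) (hΦG : ∀ p, Φ (G p) = p) (p : E)
    (hΦ : ContDiffAt ℝ n Φ (G p)) (hbij : Function.Bijective (fderiv ℝ Φ (G p))) :
    ContDiffAt ℝ n G p ∧ Function.Bijective (fderiv ℝ G p) := by
  set e : E ≃L[ℝ] E := ContinuousLinearEquiv.ofBijective (fderiv ℝ Φ (G p))
    (LinearMap.ker_eq_bot.2 hbij.1) (LinearMap.range_eq_top.2 hbij.2)
  have he : HasFDerivAt Φ (e : E →L[ℝ] E) (G p) := by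
    rw [ContinuousLinearEquiv.coe_ofBijective]
    exact (hΦ.differentiableAt hn).hasFDerivAt
  have hs := hΦ.hasStrictFDerivAt' he hn
  have hloc : G =ᶠ[𝓝 p] hΦ.localInverse he hn := by
    have h1 := hs.eventually_right_inverse
    have h2 := hs.localInverse_tendsto.eventually (hD.mem_nhds (hG p))
    rw [hΦG] at h1 h2
    filter_upwards [h1, h2] with q hq1 hq2
    exact hinj (hG q) hq2 ((hΦG q).trans hq1.symm)
  constructor
  · have := hΦ.to_localInverse he hn
    rw [hΦG] at this
    exact this.congr_of_eventuallyEq hloc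
  · have h := hs.to_localInverse.hasFDerivAt
    rw [hΦG] at h
    rw [(h.congr_of_eventuallyEq hloc).fderiv]
    exact e.symm.bijective

/-- A linear map `v ↦ (L v, v.2)` is bijective when `L` does not vanish on the first axis. -/
theorem bijective_prod_snd {E : Type*} [NormedAddCommGroup E] [NormedSpace ℝ E]
    (L : ℝ × E →L[ℝ] ℝ) (hL : L (1, 0) ≠ 0) :
    Function.Bijective (L.prod (ContinuousLinearMap.snd ℝ ℝ E)) := by
  have hsplit : ∀ (t : ℝ) (v : E), L (t, v) = t * L (1, 0) + L (0, v) := fun t v ↦ by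
    rw [← smul_eq_mul, ← map_smul, ← map_add]; simp
  constructor
  · rintro ⟨t, v⟩ ⟨t', v'⟩ h
    simp only [ContinuousLinearMap.prod_apply, ContinuousLinearMap.coe_snd', Prod.mk.injEq] at h
    obtain ⟨h, rfl⟩ := h
    rw [hsplit t, hsplit t'] at h
    rw [mul_right_cancel₀ hL (add_right_cancel h)]
  · rintro ⟨t, v⟩
    refine ⟨((t - L (0, v)) / L (1, 0), v), ?_⟩
    simp only [ContinuousLinearMap.prod_apply, ContinuousLinearMap.coe_snd', Prod.mk.injEq,
      and_true]
    rw [hsplit, div_mul_cancel₀ _ hL, sub_add_cancel]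

/-- A compact piece of the first axis inside an open set of `ℝ³` has a box neighborhood. -/
theorem exists_pos_box_subset {W : Set (ℝ × ℝ × ℝ)} (hW : IsOpen W) {K : Set ℝ}
    (hK : IsCompact K) (hKW : ∀ x ∈ K, (x, 0, 0) ∈ W) :
    ∃ δ > 0, ∀ x ∈ K, ∀ y z : ℝ, |y| < δ → |z| < δ → (x, y, z) ∈ W := by
  obtain ⟨u, v, -, hv, hKu, h0v, huv⟩ := generalized_tube_lemma hK
    (isCompact_singleton (x := ((0, 0) : ℝ × ℝ))) hW (by rintro ⟨x, -⟩ ⟨hx, rfl⟩; exact hKW x hx)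
  obtain ⟨δ, hδ, hball⟩ := Metric.isOpen_iff.1 hv (0, 0) (h0v rfl)
  refine ⟨δ, hδ, fun x hx y z hy hz ↦ huv ⟨hKu hx, hball ?_⟩⟩
  simpa [Prod.dist_eq] using And.intro hy hz

/-- The penalty `(y² + z²) k(x)`. -/
def penalty (k : ℝ → ℝ) (p : ℝ × ℝ × ℝ) : ℝ := (p.2.1 ^ 2 + p.2.2 ^ 2) * k p.1

/-- The map `(x, y, z) ↦ (x + u / (1 - u), y, z)`, where `u` is the penalty at `(x, y, z)`. -/
noncomputable def straighten (k : ℝ → ℝ) (p : ℝ × ℝ × ℝ) : ℝ × ℝ × ℝ :=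
  (p.1 + penalty k p / (1 - penalty k p), p.2)

section straighten

variable {k : ℝ → ℝ}

theorem penalty_mono (hk : Monotone k) {x x' : ℝ} (h : x ≤ x') (v : ℝ × ℝ) :
    penalty k (x, v) ≤ penalty k (x', v) :=
  mul_le_mul_of_nonneg_left (hk h) (by positivity)

theorem contDiff_penalty {n : WithTop ℕ∞} (hk : ContDiff ℝ n k) : ContDiff ℝ n (penalty k) := by
  unfold penalty
  exact (by fun_prop : ContDiff ℝ n fun p : ℝ × ℝ × ℝ ↦ p.2.1 ^ 2 + p.2.2 ^ 2).mul
    (hk.comp contDiff_fst)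

theorem contDiffAt_straighten {n : WithTop ℕ∞} (hk : ContDiff ℝ n k) {p : ℝ × ℝ × ℝ}
    (hp : penalty k p < 1) : ContDiffAt ℝ n (straighten k) p := by
  have hu := (contDiff_penalty hk).contDiffAt (x := p)
  exact (contDiffAt_fst.add (hu.div (contDiffAt_const.sub hu) (by linarith))).prodMk contDiffAt_snd

theorem straighten_injOn (hk : Monotone k) : InjOn (straighten k) {p | penalty k p < 1} := by
  have key : ∀ (x x' : ℝ) (v : ℝ × ℝ), x < x' → penalty k (x', v) < 1 →
      (straighten k (x, v)).1 < (straighten k (x', v)).1 := fun x x' v hx h' ↦ by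
    have h := penalty_mono hk hx.le v
    have : penalty k (x, v) / (1 - penalty k (x, v)) ≤
        penalty k (x', v) / (1 - penalty k (x', v)) := by
      rw [div_le_div_iff₀ (by linarith) (by linarith)]
      linarith
    exact add_lt_add_of_lt_of_le hx this
  rintro ⟨x, v⟩ hp ⟨x', v'⟩ hp' h
  obtain rfl : v = v' := congrArg Prod.snd h
  rcases lt_trichotomy x x' with hx | rfl | hx
  · exact absurd (congrArg Prod.fst h) (key x x' v hx hp').ne
  · rfl
  · exact absurd (congrArg Prod.fst h) (key x' x v hx hp).ne'

theorem bijective_fderiv_straighten (hk : Monotone k) (hk' : ContDiff ℝ (⊤ : ℕ∞) k)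
    {p : ℝ × ℝ × ℝ} (hp : penalty k p < 1) : Function.Bijective (fderiv ℝ (straighten k) p) := by
  obtain ⟨x, v⟩ := p
  have hd : DifferentiableAt ℝ (straighten k) (x, v) :=
    (contDiffAt_straighten hk' hp).differentiableAt (by simp)
  have hfst : HasFDerivAt (fun q ↦ (straighten k q).1)
      ((ContinuousLinearMap.fst ℝ ℝ (ℝ × ℝ)).comp (fderiv ℝ (straighten k) (x, v))) (x, v) :=
    hd.hasFDerivAt.fst
  set L := (ContinuousLinearMap.fst ℝ ℝ (ℝ × ℝ)).comp (fderiv ℝ (straighten k) (x, v))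
  have hprod : fderiv ℝ (straighten k) (x, v) = L.prod (ContinuousLinearMap.snd ℝ ℝ (ℝ × ℝ)) :=
    (hfst.prodMk hasFDerivAt_snd).fderiv
  rw [hprod]
  apply bijective_prod_snd
  set s := v.1 ^ 2 + v.2 ^ 2
  have hs : 0 ≤ s := by positivity
  have hline : HasDerivAt (fun t ↦ (straighten k (t, v)).1) (L (1, 0)) x :=
    hfst.comp_hasDerivAt (f := fun t ↦ (t, v)) x ((hasDerivAt_id x).prodMk (hasDerivAt_const x v))
  have hu : HasDerivAt (fun t ↦ s * k t) (s * deriv k x) x :=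
    ((hk'.differentiable (by simp)) x).hasDerivAt.const_mul s
  have hp1 : s * k x < 1 := hp
  have hne : 1 - s * k x ≠ 0 := by linarith
  have hcalc := (hasDerivAt_id x).add (hu.div (hu.const_sub 1) hne)
  rw [hline.unique hcalc]
  have h0 : 0 ≤ s * deriv k x := mul_nonneg hs hk.deriv_nonneg
  have : 0 ≤ (s * deriv k x * (1 - s * k x) - s * k x * -(s * deriv k x)) /
      (1 - s * k x) ^ 2 := by
    apply div_nonneg _ (sq_nonneg _)
    linarith
  linarith

theorem exists_straighten_eq (hk : Monotone k) (hk' : Continuous k) (h0 : ∀ x ≤ 0, k x = 0)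
    (p : ℝ × ℝ × ℝ) :
    ∃ q, penalty k q < 1 ∧ straighten k q = p ∧ min p.1 0 ≤ q.1 ∧ q.1 ≤ p.1 := by
  obtain ⟨x, v⟩ := p
  set s := v.1 ^ 2 + v.2 ^ 2
  have hs : 0 ≤ s := by positivity
  have hk0 : ∀ t, 0 ≤ k t := fun t ↦ by
    rcases le_total t 0 with h | h
    · exact (h0 t h).ge
    · exact (h0 0 le_rfl).ge.trans (hk h)
  have hcont : ContinuousOn (fun t ↦ (x - t) * (1 - s * k t) - s * k t) (Icc (min x 0) x) := by
    fun_prop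
  have hx : 0 ≤ s * k x := mul_nonneg hs (hk0 x)
  obtain ⟨t, ht, h⟩ := intermediate_value_Icc' (min_le_left x 0) hcont
    (show (0 : ℝ) ∈ _ from ⟨by simpa using hx, by simp [h0 _ (min_le_right x 0)]⟩)
  have hu : 0 ≤ s * k t := mul_nonneg hs (hk0 t)
  have hlt : s * k t < 1 := by
    by_contra! hge
    simp only at h
    nlinarith [mul_nonneg (sub_nonneg.2 ht.2) (sub_nonneg.2 hge)]
  refine ⟨(t, v), hlt, Prod.ext ?_ rfl, ht.1, ht.2⟩
  change t + s * k t / (1 - s * k t) = x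
  have hne : 1 - s * k t ≠ 0 := by linarith
  simp only at h
  field_simp
  linarith

end straighten

/-- Every open set `W ⊆ ℝ³` containing the ray `l = {(x,0,0) : x ≥ 0}`
contains a sliding neighborhood: there are `a, b > 0` and a smooth map
`F : (-b, ∞) × (-a, a) × (-a, a) → W` of the form `F(x, y, z) = (F₁(x, y, z), y, z)`,
injective and with invertible differential at every point (hence an open embedding onto
its image in `W`), which is the identity on the ray. -/
theorem exists_sliding_neighborhood
    (W : Set (ℝ × ℝ × ℝ)) (hW : IsOpen W) (hl : ray3 ⊆ W) :
    ∃ a b : ℝ, 0 < a ∧ 0 < b ∧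
      ∃ F : ℝ × ℝ × ℝ → ℝ × ℝ × ℝ,
        ContDiffOn ℝ (⊤ : ℕ∞) F (U3 a b) ∧
        Set.MapsTo F (U3 a b) W ∧
        Set.InjOn F (U3 a b) ∧
        (∀ p ∈ U3 a b, (F p).2.1 = p.2.1 ∧ (F p).2.2 = p.2.2) ∧
        (∀ p ∈ U3 a b, Function.Bijective (fderiv ℝ F p)) ∧
        (∀ x : ℝ, -b < x → F (x, 0, 0) = (x, 0, 0)) := by
  have hray : ∀ x : ℝ, 0 ≤ x → (x, 0, 0) ∈ W := fun x hx ↦ hl ⟨hx, rfl, rfl⟩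
  obtain ⟨ε, hε, hball⟩ := Metric.isOpen_iff.1 hW (0, 0, 0) (hray 0 le_rfl)
  have hb : 0 < ε / 2 := half_pos hε
  obtain ⟨a, ha, hnear⟩ := exists_pos_box_subset hW (isCompact_Icc (a := -(ε / 2)) (b := 1))
    fun x hx ↦ by
      rcases le_total 0 x with h | h
      · exact hray x h
      · apply hball
        have : |x| < ε := abs_lt.2 ⟨by linarith [hx.1], by linarith⟩
        simpa [Prod.dist_eq, hε] using this
  have hfar : ∀ n : ℕ, ∃ δ > 0, ∀ x ∈ Icc (n + 1 : ℝ) (n + 2), ∀ y z : ℝ, |y| < δ → |z| < δ →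
      (x, y, z) ∈ W := fun n ↦ exists_pos_box_subset hW isCompact_Icc
    fun x hx ↦ hray x (le_trans (by positivity) hx.1)
  choose δ hδ hfar using hfar
  obtain ⟨k, hk', hk, h0, hkδ⟩ := exists_contDiff_monotone_ge (fun n ↦ (δ n ^ 2)⁻¹)
    fun n ↦ by positivity
  choose F hFD hF hFge hFle using exists_straighten_eq hk hk'.continuous h0
  have hsnd : ∀ p, (F p).2 = p.2 := fun p ↦ by
    simpa only [straighten] using congrArg Prod.snd (hF p)
  have hopen : IsOpen {p | penalty k p < 1} :=
    isOpen_lt (contDiff_penalty hk').continuous continuous_const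
  have hsmooth := fun p ↦ contDiffAt_and_bijective_fderiv_of_rightInverse
    (n := ((⊤ : ℕ∞) : WithTop ℕ∞)) (by simp) hopen (straighten_injOn hk) hFD hF p
    (contDiffAt_straighten hk' (hFD p)) (bijective_fderiv_straighten hk hk' (hFD p))
  refine ⟨a, ε / 2, ha, hb, F, fun p _ ↦ (hsmooth p).1.contDiffWithinAt, ?_,
    (Function.LeftInverse.injective hF).injOn,
    fun p _ ↦ ⟨congrArg Prod.fst (hsnd p), congrArg Prod.snd (hsnd p)⟩,
    fun p _ ↦ (hsmooth p).2, fun x _ ↦ ?_⟩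
  · rintro ⟨x, y, z⟩ ⟨hx, hy, hz⟩
    have hge := hFge (x, y, z)
    have hlt := hFD (x, y, z)
    have hF2 := hsnd (x, y, z)
    generalize F (x, y, z) = q at hge hlt hF2 ⊢
    obtain ⟨t, v⟩ := q
    obtain rfl : v = (y, z) := hF2
    rcases le_total t 1 with ht | ht
    · refine hnear t ⟨le_trans (le_min (le_of_lt hx) (by linarith)) hge, ht⟩ y z
        (abs_lt.2 hy) (abs_lt.2 hz)
    · obtain ⟨n, hn⟩ : ∃ n : ℕ, (n : ℝ) = ⌊t - 1⌋₊ := ⟨_, rfl⟩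
      have hn1 : (n : ℝ) ≤ t - 1 := hn ▸ Nat.floor_le (by linarith)
      have hn2 : t - 1 < n + 1 := hn ▸ Nat.lt_floor_add_one _
      have hpos : 0 < δ n ^ 2 := pow_pos (hδ n) 2
      have hsq : y ^ 2 + z ^ 2 < δ n ^ 2 := by
        have h1 : (y ^ 2 + z ^ 2) * (δ n ^ 2)⁻¹ < 1 :=
          lt_of_le_of_lt (mul_le_mul_of_nonneg_left (hkδ n t (by linarith)) (by positivity)) hlt
        rwa [← div_eq_mul_inv, div_lt_one hpos] at h1
      exact hfar n t ⟨by linarith, by linarith⟩ y z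
        (abs_lt_of_sq_lt_sq (by linarith [sq_nonneg z]) (hδ n).le)
        (abs_lt_of_sq_lt_sq (by linarith [sq_nonneg y]) (hδ n).le)
  · apply straighten_injOn hk (hFD _) (by simp [penalty])
    rw [hF]
    simp [straighten, penalty]
end

section
/- Let a, b, c be real numbers with (a, b) ≠ (0, 0). On ℂ² ≅ ℝ⁴ consider the two quadratic forms Q₁(z₁, z₂) := 2π·a·Re(z₁z₂) + 2π·b·Im(z₁z₂) + c·π(|z₁|² − |z₂|²) and Q₂(z₁, z₂) := π(|z₁|² − |z₂|²). Then Q₁ and Q₂ are linearly independent quadratic forms, and there exists a basis (e₁, f₁, e₂, f₂) of ℝ⁴ which is symplectic for the standard symplectic form ω₀ (that is, ω₀(e₁, f₁) = ω₀(e₂, f₂) = 1 and ω₀ vanishes on all other pairs of distinct basis vectors, and ω₀(e₁,e₂)=ω₀(f₁,f₂)=0) such that, writing (x₁, y₁, x₂, y₂) for the linear coordinates dual to this basis, both Q₁ and Q₂ are real linear combinations of the two quadratic forms x₁y₁ + x₂y₂ and x₁y₂ − x₂y₁. -/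
/-- The standard symplectic form `ω₀(u, v) = Im(conj u₁ · v₁) + Im(conj u₂ · v₂)`
on `ℂ² ≅ ℝ⁴`. -/
def omega0 (u v : ℂ × ℂ) : ℝ :=
  ((starRingEnd ℂ) u.1 * v.1).im + ((starRingEnd ℂ) u.2 * v.2).im

/-- The quadratic form `Q₁ = 2πa·Re(z₁z₂) + 2πb·Im(z₁z₂) + cπ(|z₁|² − |z₂|²)`. -/
noncomputable def Q1 (a b c : ℝ) (p : ℂ × ℂ) : ℝ :=
  2 * Real.pi * a * (p.1 * p.2).re + 2 * Real.pi * b * (p.1 * p.2).im +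
    c * Real.pi * (Complex.normSq p.1 - Complex.normSq p.2)

/-- The quadratic form `Q₂ = π(|z₁|² − |z₂|²)`. -/
noncomputable def Q2 (p : ℂ × ℂ) : ℝ :=
  Real.pi * (Complex.normSq p.1 - Complex.normSq p.2)

/-- The real linear functional on `ℂ²` with the given coefficients on the coordinates
`Re z₁, Im z₁, Re z₂, Im z₂`. -/
noncomputable def realFunctional (k l m n : ℝ) : (ℂ × ℂ) →ₗ[ℝ] ℝ :=
  (k • Complex.reLm + l • Complex.imLm) ∘ₗ LinearMap.fst ℝ ℂ ℂ +
    (m • Complex.reLm + n • Complex.imLm) ∘ₗ LinearMap.snd ℝ ℂ ℂ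

theorem realFunctional_apply (k l m n : ℝ) (v : ℂ × ℂ) :
    realFunctional k l m n v = k * v.1.re + l * v.1.im + (m * v.2.re + n * v.2.im) := by
  simp [realFunctional]

theorem Q1_Q2_linearIndependent (a b c : ℝ) (hab : (a, b) ≠ ((0 : ℝ), (0 : ℝ)))
    (s t : ℝ) (h : ∀ p : ℂ × ℂ, s * Q1 a b c p + t * Q2 p = 0) : s = 0 ∧ t = 0 := by
  have hπ := Real.pi_ne_zero
  have hre := h (1, 1)
  have him := h (1, Complex.I)
  have hdiag := h (1, 0)
  simp [Q1, Q2, hπ] at hre him hdiag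
  have hs : s = 0 := by
    by_contra hs
    exact hab (Prod.ext (hre.resolve_left hs) (him.resolve_left hs))
  refine ⟨hs, ?_⟩
  simpa [hs, hπ] using hdiag

/-- A unit complex number `p + iq` rotating the first factor of `ℂ²` turns the pair of forms
with `(a, b) = r(p, q)` into the one with `(a, b) = (r, 0)`; the basis below is the resulting
rotation of a symplectic basis adapted to `Re(z₁z₂)` and `|z₁|² − |z₂|²`. -/
theorem exists_symplectic_basis_of_unit (r p q c : ℝ) (hpq : p ^ 2 + q ^ 2 = 1) :
    ∃ (e₁ f₁ e₂ f₂ : ℂ × ℂ) (x₁ y₁ x₂ y₂ : (ℂ × ℂ) →ₗ[ℝ] ℝ),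
      (∀ v : ℂ × ℂ, v = x₁ v • e₁ + y₁ v • f₁ + x₂ v • e₂ + y₂ v • f₂) ∧
      omega0 e₁ f₁ = 1 ∧ omega0 e₂ f₂ = 1 ∧
      omega0 e₁ e₂ = 0 ∧ omega0 e₁ f₂ = 0 ∧ omega0 f₁ e₂ = 0 ∧ omega0 f₁ f₂ = 0 ∧
      ∃ α β γ δ : ℝ,
        (∀ v : ℂ × ℂ,
          Q1 (r * p) (r * q) c v = α * (x₁ v * y₁ v + x₂ v * y₂ v) + β * (x₁ v * y₂ v - x₂ v * y₁ v)) ∧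
        (∀ v : ℂ × ℂ,
          Q2 v = γ * (x₁ v * y₁ v + x₂ v * y₂ v) + δ * (x₁ v * y₂ v - x₂ v * y₁ v)) := by
  refine ⟨(⟨(p + q) / 2, (q - p) / 2⟩, ⟨1 / 2, -1 / 2⟩),
    (⟨(p - q) / 2, (p + q) / 2⟩, ⟨1 / 2, 1 / 2⟩),
    (⟨(p - q) / 2, (p + q) / 2⟩, ⟨-1 / 2, -1 / 2⟩),
    (⟨(-p - q) / 2, (p - q) / 2⟩, ⟨1 / 2, -1 / 2⟩),
    realFunctional ((p + q) / 2) ((q - p) / 2) (1 / 2) (-1 / 2),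
    realFunctional ((p - q) / 2) ((p + q) / 2) (1 / 2) (1 / 2),
    realFunctional ((p - q) / 2) ((p + q) / 2) (-1 / 2) (-1 / 2),
    realFunctional ((-p - q) / 2) ((p - q) / 2) (1 / 2) (-1 / 2),
    ?_, ?_, ?_, ?_, ?_, ?_, ?_, 2 * Real.pi * r, -2 * Real.pi * c, 0, -2 * Real.pi, ?_, ?_⟩
  · rintro ⟨⟨s, t⟩, ⟨m, n⟩⟩
    refine Prod.ext (Complex.ext ?_ ?_) (Complex.ext ?_ ?_) <;> simp [realFunctional_apply]
    · linear_combination (-s) * hpq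
    · linear_combination (-t) * hpq
    · ring
    · ring
  · simp [omega0]
    linear_combination hpq / 2
  · simp [omega0]
    linear_combination hpq / 2
  · simp [omega0]
    linear_combination hpq / 2
  · simp [omega0]
    ring
  · simp [omega0]
    ring
  · simp [omega0]
    linear_combination hpq / 2
  · rintro ⟨⟨s, t⟩, ⟨m, n⟩⟩
    simp [realFunctional_apply, Q1, Complex.normSq_apply]
    linear_combination (-c * Real.pi * (s ^ 2 + t ^ 2)) * hpq
  · rintro ⟨⟨s, t⟩, ⟨m, n⟩⟩
    simp [realFunctional_apply, Q2, Complex.normSq_apply]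
    linear_combination (-Real.pi * (s ^ 2 + t ^ 2)) * hpq

/-- For `(a, b) ≠ (0, 0)`, the quadratic forms `Q₁` and `Q₂` are
linearly independent, and there is a symplectic basis `(e₁, f₁, e₂, f₂)` of
`(ℂ² ≅ ℝ⁴, ω₀)` in whose dual linear coordinates `(x₁, y₁, x₂, y₂)` both `Q₁` and `Q₂`
are real linear combinations of the focus-focus quadratic forms `x₁y₁ + x₂y₂` and
`x₁y₂ − x₂y₁`. -/
theorem focus_focus_normal_form
    (a b c : ℝ) (hab : (a, b) ≠ ((0 : ℝ), (0 : ℝ))) :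
    (∀ s t : ℝ, (∀ p : ℂ × ℂ, s * Q1 a b c p + t * Q2 p = 0) → s = 0 ∧ t = 0) ∧
    ∃ (e₁ f₁ e₂ f₂ : ℂ × ℂ) (x₁ y₁ x₂ y₂ : (ℂ × ℂ) →ₗ[ℝ] ℝ),
      (∀ v : ℂ × ℂ, v = x₁ v • e₁ + y₁ v • f₁ + x₂ v • e₂ + y₂ v • f₂) ∧
      omega0 e₁ f₁ = 1 ∧ omega0 e₂ f₂ = 1 ∧
      omega0 e₁ e₂ = 0 ∧ omega0 e₁ f₂ = 0 ∧ omega0 f₁ e₂ = 0 ∧ omega0 f₁ f₂ = 0 ∧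
      ∃ α β γ δ : ℝ,
        (∀ p : ℂ × ℂ,
          Q1 a b c p = α * (x₁ p * y₁ p + x₂ p * y₂ p) + β * (x₁ p * y₂ p - x₂ p * y₁ p)) ∧
        (∀ p : ℂ × ℂ,
          Q2 p = γ * (x₁ p * y₁ p + x₂ p * y₂ p) + δ * (x₁ p * y₂ p - x₂ p * y₁ p)) := by
  refine ⟨Q1_Q2_linearIndependent a b c hab, ?_⟩
  have hpos : 0 < a ^ 2 + b ^ 2 := by
    by_contra! h
    exact hab (Prod.ext (by nlinarith [sq_nonneg a, sq_nonneg b])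
      (by nlinarith [sq_nonneg a, sq_nonneg b]))
  set r := √(a ^ 2 + b ^ 2)
  have hr0 : r ≠ 0 := (Real.sqrt_pos.mpr hpos).ne'
  have hr2 : r ^ 2 = a ^ 2 + b ^ 2 := Real.sq_sqrt hpos.le
  have hunit : (a / r) ^ 2 + (b / r) ^ 2 = 1 := by
    field_simp
    exact hr2.symm
  simpa only [mul_div_cancel₀ _ hr0] using exists_symplectic_basis_of_unit r (a / r) (b / r) c hunit
end

section
/- Let m be a natural number and let X : ℝ^m → ℝ^m be a continuously differentiable vector field such that the operator norm of its derivative satisfies ‖DX(x)‖ ≤ C for all x ∈ ℝ^m, where C is a constant with C < 2π. Then every continuously differentiable 1-periodic solution of the ODE γ' = X ∘ γ is constant: if γ : ℝ → ℝ^m satisfies γ(t + 1) = γ(t) and γ'(t) = X(γ(t)) for all t, then γ is a constant map. -/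
/-- **Wirtinger's inequality** for complex-valued functions: a `C¹` function on `[a, b]` with equal
values at the endpoints and mean zero satisfies `(2π / (b - a))² ∫ ‖f‖² ≤ ∫ ‖f'‖²`. -/
theorem wirtinger_complex {a b : ℝ} (hab : a < b) {f f' : ℝ → ℂ}
    (hf : ∀ x, HasDerivAt f (f' x) x) (hf' : Continuous f') (hends : f a = f b)
    (hmean : ∫ x in a..b, f x = 0) :
    (2 * Real.pi / (b - a)) ^ 2 * ∫ x in a..b, ‖f x‖ ^ 2 ≤ ∫ x in a..b, ‖f' x‖ ^ 2 := by
  have hba : 0 < b - a := sub_pos.2 hab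
  have hfc : Continuous f := continuous_iff_continuousAt.2 fun x => (hf x).continuousAt
  have memLp {g : ℝ → ℂ} (hg : Continuous g) :
      MeasureTheory.MemLp g 2 (MeasureTheory.volume.restrict (Set.Ioc a b)) :=
    (MeasureTheory.memLp_two_iff_integrable_sq_norm hg.aestronglyMeasurable).2
      (hg.norm.pow 2).integrableOn_Ioc
  have coeff (n : ℤ) : (2 * Real.pi / (b - a)) ^ 2 * ‖fourierCoeffOn hab f n‖ ^ 2 ≤
      ‖fourierCoeffOn hab f' n‖ ^ 2 := by
    rcases eq_or_ne n 0 with rfl | hn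
    · have : fourierCoeffOn hab f 0 = 0 := by
        rw [fourierCoeffOn_eq_integral]
        simp [hmean]
      rw [this]
      simp
    · have hn1 : (1 : ℝ) ≤ |(n : ℝ)| := by exact_mod_cast Int.one_le_abs hn
      have key := fourierCoeffOn_of_hasDerivAt hab hn (fun x _ => hf x)
        (hf'.intervalIntegrable a b)
      have hnorm : ‖fourierCoeffOn hab f n‖ =
          (b - a) / (2 * Real.pi * |(n : ℝ)|) * ‖fourierCoeffOn hab f' n‖ := by
        rw [key, hends, sub_self, mul_zero, zero_sub, norm_mul, norm_neg, norm_mul,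
          ← Complex.ofReal_sub, Complex.norm_real, Real.norm_of_nonneg hba.le]
        simp [abs_of_pos Real.pi_pos]
        ring
      rw [← mul_pow]
      refine pow_le_pow_left₀ (by positivity) ?_ 2
      have hπ := Real.pi_pos
      have : 2 * Real.pi / (b - a) * ‖fourierCoeffOn hab f n‖ =
          ‖fourierCoeffOn hab f' n‖ / |(n : ℝ)| := by
        rw [hnorm]
        field_simp
      rw [this]
      exact div_le_self (norm_nonneg _) hn1
  have h := hasSum_le coeff ((hasSum_sq_fourierCoeffOn hab (memLp hfc)).mul_left _)
    (hasSum_sq_fourierCoeffOn hab (memLp hf'))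
  rw [smul_eq_mul, smul_eq_mul, mul_left_comm] at h
  exact le_of_mul_le_mul_left h (inv_pos.2 hba)

/-- **Wirtinger's inequality** for functions with values in a Euclidean space. -/
theorem wirtinger_euclidean {ι : Type*} [Fintype ι] {a b : ℝ} (hab : a < b)
    {f f' : ℝ → EuclideanSpace ℝ ι} (hf : ∀ x, HasDerivAt f (f' x) x) (hf' : Continuous f')
    (hends : f a = f b) (hmean : ∫ x in a..b, f x = 0) :
    (2 * Real.pi / (b - a)) ^ 2 * ∫ x in a..b, ‖f x‖ ^ 2 ≤ ∫ x in a..b, ‖f' x‖ ^ 2 := by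
  have hfc : Continuous f := continuous_iff_continuousAt.2 fun x => (hf x).continuousAt
  simp_rw [EuclideanSpace.norm_sq_eq]
  rw [intervalIntegral.integral_finsetSum
      fun i _ => Continuous.intervalIntegrable (by fun_prop) a b,
    intervalIntegral.integral_finsetSum
      fun i _ => Continuous.intervalIntegrable (by fun_prop) a b, Finset.mul_sum]
  refine Finset.sum_le_sum fun i _ => ?_
  have hcoord : ∫ x in a..b, f x i = 0 := by
    have := (EuclideanSpace.proj (𝕜 := ℝ) i).intervalIntegral_comp_comm
      (hfc.intervalIntegrable (μ := MeasureTheory.volume) a b)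
    simpa [hmean] using this
  have := wirtinger_complex hab (f := fun x => (f x i : ℂ)) (f' := fun x => (f' x i : ℂ))
    (fun x => ((EuclideanSpace.proj (𝕜 := ℝ) i).hasFDerivAt.comp_hasDerivAt x (hf x)).ofReal_comp)
    (by fun_prop) (by rw [hends])
    (by rw [intervalIntegral.integral_ofReal, hcoord, Complex.ofReal_zero])
  simpa only [Complex.norm_real] using this

/-- Let `X` be a `C¹` vector field on `ℝ^m` whose derivative is bounded
in operator norm by a constant `C < 2π`.  Then every continuously differentiable
`1`-periodic solution of `γ' = X ∘ γ` is constant. -/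
theorem periodic_orbits_constant_of_small_derivative
    (m : ℕ) (C : ℝ) (hC : C < 2 * Real.pi)
    (X : EuclideanSpace ℝ (Fin m) → EuclideanSpace ℝ (Fin m))
    (hX : ContDiff ℝ 1 X)
    (hDX : ∀ x, ‖fderiv ℝ X x‖ ≤ C)
    (γ : ℝ → EuclideanSpace ℝ (Fin m))
    (hγ : ContDiff ℝ 1 γ)
    (hper : ∀ t : ℝ, γ (t + 1) = γ t)
    (hode : ∀ t : ℝ, deriv γ t = X (γ t)) :
    ∀ s t : ℝ, γ s = γ t := by
  have hγd : Differentiable ℝ γ := hγ.differentiable one_ne_zero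
  have hγ' (t : ℝ) : HasDerivAt γ (X (γ t)) t := hode t ▸ (hγd t).hasDerivAt
  have hXγ (t : ℝ) : HasDerivAt (fun t => X (γ t)) (fderiv ℝ X (γ t) (X (γ t))) t :=
    ((hX.differentiable one_ne_zero) (γ t)).hasFDerivAt.comp_hasDerivAt t (hγ' t)
  have hXγc : Continuous fun t => X (γ t) := hX.continuous.comp hγ.continuous
  have hDXγc : Continuous fun t => fderiv ℝ X (γ t) (X (γ t)) :=
    ((hX.continuous_fderiv one_ne_zero).comp hγ.continuous).clm_apply hXγc
  have hC0 : 0 ≤ C := (norm_nonneg _).trans (hDX 0)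
  refine is_const_of_deriv_eq_zero hγd fun t => ?_
  rw [hode]
  by_contra hne
  have ht : t < t + 1 := lt_add_one t
  have hpos : 0 < ∫ x in t..t + 1, ‖X (γ x)‖ ^ 2 :=
    intervalIntegral.integral_pos ht (hXγc.norm.pow 2).continuousOn (fun x _ => by positivity)
      ⟨t, Set.left_mem_Icc.2 ht.le, by positivity⟩
  have hmean : ∫ x in t..t + 1, X (γ x) = 0 := by
    rw [intervalIntegral.integral_eq_sub_of_hasDerivAt (fun x _ => hγ' x)
      (hXγc.intervalIntegrable _ _), hper, sub_self]
  have hwirt := wirtinger_euclidean ht hXγ hDXγc (by simp only [hper]) hmean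
  have hle : ∫ x in t..t + 1, ‖fderiv ℝ X (γ x) (X (γ x))‖ ^ 2 ≤
      C ^ 2 * ∫ x in t..t + 1, ‖X (γ x)‖ ^ 2 := by
    rw [← intervalIntegral.integral_const_mul]
    refine intervalIntegral.integral_mono_on ht.le
      (Continuous.intervalIntegrable (by fun_prop) _ _)
      (Continuous.intervalIntegrable (by fun_prop) _ _) fun x _ => ?_
    rw [← mul_pow]
    exact pow_le_pow_left₀ (norm_nonneg _) ((fderiv ℝ X (γ x)).le_of_opNorm_le (hDX _) _) 2
  rw [add_sub_cancel_left, div_one] at hwirt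
  have hlt : C ^ 2 < (2 * Real.pi) ^ 2 := pow_lt_pow_left₀ hC hC0 two_ne_zero
  exact absurd (hwirt.trans hle) (not_le.2 (mul_lt_mul_of_pos_right hlt hpos))
end

section
/- Let S ⊆ ℝ² be a closed set and define C := {(t, u, ζ) ∈ ℝ × ℝ² × Circle : t ≥ 0, u ∈ S, ζ = 1}, a closed subset of the smooth 4-manifold ℝ × ℝ² × Circle. Then for every ε > 0 there exists a diffeomorphism χ from the open manifold (ℝ × ℝ² × Circle) ∖ C onto ℝ × ℝ² × Circle of the form χ(t, u, ζ) = (χ₁(t, u, ζ), u, ζ) (so χ preserves the ℝ²-coordinate and the circle coordinate), such that χ(t, u, ζ) = (t, u, ζ) whenever the Euclidean distance from (t, u) ∈ ℝ × ℝ² = ℝ³ to the set [0, ∞) × S is at least ε, or ζ lies outside the arc {e^{2πis} : s ∈ ℝ, |s| < ε}. -/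
open scoped Manifold

/-- The model with corners for the smooth manifold `(ℝ × ℝ²) × Circle`. -/
noncomputable def Imod : ModelWithCorners ℝ ((ℝ × ℝ × ℝ) × EuclideanSpace ℝ (Fin 1))
    (ModelProd (ℝ × ℝ × ℝ) (EuclideanSpace ℝ (Fin 1))) :=
  (𝓘(ℝ, ℝ × ℝ × ℝ)).prod (𝓡 1)

/-- The coisotropic-lift set `C = {(t, u, ζ) : t ≥ 0, u ∈ S, ζ = 1}` inside
`ℝ × ℝ² × Circle`; here a point is written `((t, u₁, u₂), ζ)`. -/
def liftC (S : Set (ℝ × ℝ)) : Set ((ℝ × ℝ × ℝ) × Circle) :=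
  {p | 0 ≤ p.1.1 ∧ p.1.2 ∈ S ∧ p.2 = 1}

/-- The Euclidean distance on `ℝ × ℝ² = ℝ³`. -/
noncomputable def eucDist3 (p q : ℝ × ℝ × ℝ) : ℝ :=
  Real.sqrt ((p.1 - q.1) ^ 2 + (p.2.1 - q.2.1) ^ 2 + (p.2.2 - q.2.2) ^ 2)

open Filter Topology Set

section InverseFunction

variable {Y : Type*} [NormedAddCommGroup Y] [NormedSpace ℝ Y] [CompleteSpace Y]

/-- The linear map `(a, b) ↦ (L (a, b), b)` is invertible when `L (1, 0) ≠ 0`. -/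
noncomputable def shearEquiv (L : ℝ × Y →L[ℝ] ℝ) (hL : L (1, 0) ≠ 0) :
    (ℝ × Y) ≃L[ℝ] (ℝ × Y) :=
  ContinuousLinearEquiv.equivOfInverse (L.prod (ContinuousLinearMap.snd ℝ ℝ Y))
    (((L (1, 0))⁻¹ • (ContinuousLinearMap.fst ℝ ℝ Y -
      (L.comp (ContinuousLinearMap.inr ℝ ℝ Y)).comp (ContinuousLinearMap.snd ℝ ℝ Y))).prod
        (ContinuousLinearMap.snd ℝ ℝ Y))
    (by
      rintro ⟨a, b⟩
      have h : L (a, b) = a * L (1, 0) + L (0, b) := by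
        rw [← smul_eq_mul, ← map_smul, ← map_add]; simp
      ext
      · simp only [ContinuousLinearMap.prod_apply, ContinuousLinearMap.coe_snd', h]
        simp [mul_comm a, hL]
      · simp)
    (by
      rintro ⟨a, b⟩
      have h : ∀ x : ℝ, L (x, b) = x * L (1, 0) + L (0, b) := by
        intro x
        rw [← smul_eq_mul, ← map_smul, ← map_add]; simp
      ext
      · simp only [ContinuousLinearMap.prod_apply, ContinuousLinearMap.coe_snd']
        rw [h]
        simp [hL, mul_comm (L (1, 0))⁻¹]
      · simp)

/-- A fibrewise inverse of a smooth function whose fibre derivative does not vanish is smooth. -/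
theorem contDiff_fiberwise_inverse {φ G : ℝ × Y → ℝ} {W : Set (ℝ × Y)} (hW : IsOpen W)
    (hφ : ContDiffOn ℝ (⊤ : ℕ∞) φ W)
    (hder : ∀ p ∈ W, fderiv ℝ φ p (1, 0) ≠ 0)
    (hGW : ∀ p : ℝ × Y, (G p, p.2) ∈ W)
    (hφG : ∀ p : ℝ × Y, φ (G p, p.2) = p.1)
    (hGφ : ∀ p ∈ W, G (φ p, p.2) = p.1) :
    ContDiff ℝ (⊤ : ℕ∞) G := by
  rw [contDiff_iff_contDiffAt]
  intro p
  set q : ℝ × Y := (G p, p.2) with hq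
  have hφq : ContDiffAt ℝ (⊤ : ℕ∞) φ q := hφ.contDiffAt (hW.mem_nhds (hGW p))
  set Φ : ℝ × Y → ℝ × Y := fun x => (φ x, x.2) with hΦ
  have hΦq : ContDiffAt ℝ (⊤ : ℕ∞) Φ q := hφq.prodMk contDiffAt_snd
  have hn : ((⊤ : ℕ∞) : WithTop ℕ∞) ≠ 0 := by simp
  have hΦ' : HasFDerivAt Φ
      (shearEquiv (fderiv ℝ φ q) (hder q (hGW p)) : ℝ × Y →L[ℝ] ℝ × Y) q :=
    (hφq.differentiableAt hn).hasFDerivAt.prodMk hasFDerivAt_snd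
  have hΦp : Φ q = p := Prod.ext (hφG p) rfl
  set l := hΦq.localInverse hΦ' hn with hl
  have hlC : ContDiffAt ℝ (⊤ : ℕ∞) l p := by
    have := hΦq.to_localInverse hΦ' hn
    rwa [hΦp] at this
  have hlp : l p = q := by
    have := hΦq.localInverse_apply_image hΦ' hn
    rwa [hΦp] at this
  have hright : ∀ᶠ x in 𝓝 p, Φ (l x) = x := by
    have := (hΦq.hasStrictFDerivAt' hΦ' hn).eventually_right_inverse
    rwa [hΦp] at this
  have hlW : ∀ᶠ x in 𝓝 p, l x ∈ W := by
    refine hlC.continuousAt.eventually_mem (hW.mem_nhds ?_)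
    rw [hlp]; exact hGW p
  refine (contDiffAt_fst.comp p hlC).congr_of_eventuallyEq ?_
  filter_upwards [hright, hlW] with x hx hxW
  have := hGφ _ hxW
  change G (Φ (l x)) = _ at this
  rwa [hx] at this

end InverseFunction

section Stretch

variable {Y : Type*} {δ : ℝ} {ρ f : Y → ℝ}

/-- The denominator of the stretching function: it vanishes exactly where `t ≥ 0` and `f = 0`. -/
noncomputable def stretchDenom (f : Y → ℝ) (p : ℝ × Y) : ℝ :=
  expNegInvGlue (-p.1) + f p.2

/-- A fibrewise increasing function pushing the end of each half line `t < 0` over a zero of `f`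
off to infinity. -/
noncomputable def stretch (δ : ℝ) (ρ f : Y → ℝ) (p : ℝ × Y) : ℝ :=
  p.1 + ρ p.2 * expNegInvGlue (p.1 + δ) / stretchDenom f p

theorem stretchDenom_pos_iff (hf : ∀ y, 0 ≤ f y) (p : ℝ × Y) :
    0 < stretchDenom f p ↔ p ∉ Ici (0 : ℝ) ×ˢ {y | f y = 0} := by
  have h1 := expNegInvGlue.nonneg (-p.1)
  have h2 := hf p.2
  simp only [stretchDenom, mem_prod, mem_Ici, mem_ofPred_eq, not_and]
  constructor
  · intro h h0 hz
    rw [expNegInvGlue.zero_of_nonpos (by linarith), hz] at h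
    simp at h
  · intro h
    by_cases h0 : 0 ≤ p.1
    · have := lt_of_le_of_ne h2 (Ne.symm (h h0)); linarith
    · have := expNegInvGlue.pos_of_pos (x := -p.1) (by linarith); linarith

theorem stretchDenom_antitone {s t : ℝ} (hst : s ≤ t) (y : Y) :
    stretchDenom f (t, y) ≤ stretchDenom f (s, y) := by
  have := expNegInvGlue.monotone (neg_le_neg hst)
  simpa [stretchDenom] using this

theorem stretch_eq_of_weight_eq_zero {p : ℝ × Y} (h : ρ p.2 = 0) : stretch δ ρ f p = p.1 := by
  simp [stretch, h]

theorem stretch_eq_of_le {p : ℝ × Y} (h : p.1 ≤ -δ) : stretch δ ρ f p = p.1 := by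
  simp [stretch, expNegInvGlue.zero_of_nonpos (x := p.1 + δ) (by linarith)]

theorem stretch_lt_stretch (hρ : ∀ y, 0 ≤ ρ y) {s t : ℝ} {y : Y} (hst : s < t)
    (ht : 0 < stretchDenom f (t, y)) : stretch δ ρ f (s, y) < stretch δ ρ f (t, y) := by
  have hD := stretchDenom_antitone (f := f) hst.le y
  have hβ : expNegInvGlue (s + δ) ≤ expNegInvGlue (t + δ) :=
    expNegInvGlue.monotone (by linarith)
  have : ρ y * expNegInvGlue (s + δ) / stretchDenom f (s, y) ≤
      ρ y * expNegInvGlue (t + δ) / stretchDenom f (t, y) :=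
    div_le_div₀ (mul_nonneg (hρ y) (expNegInvGlue.nonneg _))
      (mul_le_mul_of_nonneg_left hβ (hρ y)) ht hD
  simp only [stretch]
  linarith

theorem stretch_injective_fiber (hρ : ∀ y, 0 ≤ ρ y) {s t : ℝ} {y : Y}
    (hs : 0 < stretchDenom f (s, y)) (ht : 0 < stretchDenom f (t, y))
    (h : stretch δ ρ f (s, y) = stretch δ ρ f (t, y)) : s = t := by
  rcases lt_trichotomy s t with hlt | heq | hlt
  · exact absurd h (stretch_lt_stretch hρ hlt ht).ne
  · exact heq
  · exact absurd h (stretch_lt_stretch hρ hlt hs).ne'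

theorem le_stretch (hρ : ∀ y, 0 ≤ ρ y) {p : ℝ × Y} (hp : 0 < stretchDenom f p) :
    p.1 ≤ stretch δ ρ f p := by
  have : 0 ≤ ρ p.2 * expNegInvGlue (p.1 + δ) / stretchDenom f p :=
    div_nonneg (mul_nonneg (hρ _) (expNegInvGlue.nonneg _)) hp.le
  simp only [stretch]
  linarith

theorem hasDerivAt_expNegInvGlue (x : ℝ) :
    HasDerivAt expNegInvGlue (deriv expNegInvGlue x) x :=
  ((expNegInvGlue.contDiff (n := 1)).differentiable (by simp) x).hasDerivAt

theorem exists_hasDerivAt_stretch (hρ : ∀ y, 0 ≤ ρ y) {t : ℝ} {y : Y}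
    (ht : 0 < stretchDenom f (t, y)) :
    ∃ c : ℝ, 1 ≤ c ∧ HasDerivAt (fun s => stretch δ ρ f (s, y)) c t := by
  have hpos : ∀ x, 0 ≤ deriv expNegInvGlue x := fun x => expNegInvGlue.monotone.deriv_nonneg
  have hβ : HasDerivAt (fun s : ℝ => expNegInvGlue (s + δ)) (deriv expNegInvGlue (t + δ)) t :=
    (hasDerivAt_expNegInvGlue (t + δ)).comp_add_const t δ
  have hh : HasDerivAt (fun s : ℝ => stretchDenom f (s, y)) (-deriv expNegInvGlue (-t)) t := by
    have := ((hasDerivAt_expNegInvGlue (-t)).comp t (hasDerivAt_neg t)).add_const (f y)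
    simpa [stretchDenom, Function.comp_def] using this
  refine ⟨_, ?_, (hasDerivAt_id t).add ((hβ.const_mul (ρ y)).div hh ht.ne')⟩
  have h1 := mul_nonneg (mul_nonneg (hρ y) (hpos (t + δ))) ht.le
  have h2 := mul_nonneg (mul_nonneg (hρ y) (expNegInvGlue.nonneg (t + δ))) (hpos (-t))
  have : 0 ≤ (ρ y * deriv expNegInvGlue (t + δ) * stretchDenom f (t, y) -
      ρ y * expNegInvGlue (t + δ) * -deriv expNegInvGlue (-t)) / stretchDenom f (t, y) ^ 2 :=
    div_nonneg (by linarith) (sq_nonneg _)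
  linarith

theorem exists_le_stretch (hδ : 0 < δ) (hρ : ∀ y, 0 ≤ ρ y) (hf : ∀ y, 0 ≤ f y)
    (hρf : ∀ y, f y = 0 → 0 < ρ y) (τ : ℝ) (y : Y) :
    ∃ t, 0 < stretchDenom f (t, y) ∧ τ ≤ stretch δ ρ f (t, y) := by
  by_cases hy : f y = 0
  swap
  · have : 0 < stretchDenom f (τ, y) := (stretchDenom_pos_iff hf _).2 (by simp [hy])
    exact ⟨τ, this, le_stretch hρ this⟩
  set b := ρ y * expNegInvGlue (δ / 2) with hb
  have hb0 : 0 < b := mul_pos (hρf y hy) (expNegInvGlue.pos_of_pos (by linarith))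
  have hlim : Tendsto (fun t : ℝ => (|τ| + δ) * expNegInvGlue (-t)) (𝓝[<] 0) (𝓝 0) := by
    have hc : Continuous (fun t : ℝ => (|τ| + δ) * expNegInvGlue (-t)) :=
      continuous_const.mul ((expNegInvGlue.contDiff (n := 0)).continuous.comp continuous_neg)
    have := hc.tendsto 0
    simp only [neg_zero, expNegInvGlue.zero, mul_zero] at this
    exact this.mono_left nhdsWithin_le_nhds
  have hev : ∀ᶠ t : ℝ in 𝓝[<] 0, -(δ / 2) < t :=
    nhdsWithin_le_nhds (lt_mem_nhds (by linarith))
  obtain ⟨t, ht1, ht2, ht3⟩ :=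
    ((hlim.eventually (gt_mem_nhds hb0)).and (hev.and self_mem_nhdsWithin)).exists
  have ht3 : t < 0 := ht3
  have hD : 0 < stretchDenom f (t, y) :=
    (stretchDenom_pos_iff hf _).2 (by simp [ht3])
  refine ⟨t, hD, ?_⟩
  have hle : b ≤ ρ y * expNegInvGlue (t + δ) :=
    mul_le_mul_of_nonneg_left (expNegInvGlue.monotone (by linarith)) (hρ y)
  have hquot : |τ| + δ ≤ ρ y * expNegInvGlue (t + δ) / stretchDenom f (t, y) := by
    rw [le_div_iff₀ hD]
    simp only [stretchDenom, hy, add_zero]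
    linarith
  have := le_abs_self τ
  simp only [stretch]
  linarith

theorem exists_stretch_eq (hδ : 0 < δ) (hρ : ∀ y, 0 ≤ ρ y) (hf : ∀ y, 0 ≤ f y)
    (hρf : ∀ y, f y = 0 → 0 < ρ y) (τ : ℝ) (y : Y) :
    ∃ t, 0 < stretchDenom f (t, y) ∧ stretch δ ρ f (t, y) = τ := by
  obtain ⟨t₁, hD₁, ht₁⟩ := exists_le_stretch hδ hρ hf hρf τ y
  set t₀ := min (min τ (-δ)) t₁ with ht₀
  have h0 : stretch δ ρ f (t₀, y) ≤ τ := by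
    rw [stretch_eq_of_le ((min_le_left _ _).trans (min_le_right _ _))]
    exact (min_le_left _ _).trans (min_le_left _ _)
  have hD : ∀ t ∈ Icc t₀ t₁, 0 < stretchDenom f (t, y) := fun t ht =>
    hD₁.trans_le (stretchDenom_antitone ht.2 y)
  have hcont : ContinuousOn (fun t => stretch δ ρ f (t, y)) (Icc t₀ t₁) := fun t ht => by
    obtain ⟨c, -, hc⟩ := exists_hasDerivAt_stretch (δ := δ) hρ (hD t ht)
    exact hc.continuousAt.continuousWithinAt
  obtain ⟨t, ht, hteq⟩ := intermediate_value_Icc (min_le_right _ _) hcont ⟨h0, ht₁⟩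
  exact ⟨t, hD t ht, hteq⟩

end Stretch

/-- In `ℝ × Y` the closed set `[0, ∞) × K` can be removed by a fibrewise diffeomorphism which is
the identity for `t ≤ -δ` and outside a given neighbourhood of `K`. -/
theorem exists_fiberwise_diffeo_removing_halfline {Y : Type*} [NormedAddCommGroup Y]
    [NormedSpace ℝ Y] [FiniteDimensional ℝ Y] {K U : Set Y} (hK : IsClosed K) (hU : IsOpen U)
    (hKU : K ⊆ U) {δ : ℝ} (hδ : 0 < δ) :
    ∃ φ G : ℝ × Y → ℝ,
      ContDiffOn ℝ (⊤ : ℕ∞) φ (Ici (0 : ℝ) ×ˢ K)ᶜ ∧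
      ContDiff ℝ (⊤ : ℕ∞) G ∧
      (∀ p : ℝ × Y, (G p, p.2) ∈ (Ici (0 : ℝ) ×ˢ K)ᶜ) ∧
      (∀ p ∈ (Ici (0 : ℝ) ×ˢ K)ᶜ, G (φ p, p.2) = p.1) ∧
      (∀ p : ℝ × Y, φ (G p, p.2) = p.1) ∧
      (∀ p : ℝ × Y, p.2 ∉ U ∨ p.1 ≤ -δ → φ p = p.1) := by
  obtain ⟨f, hfs, hfC, hfr⟩ := hK.isOpen_compl.exists_contDiff_support_eq (n := ⊤)
  obtain ⟨ρ, hρs, hρC, hρr⟩ := hU.exists_contDiff_support_eq (n := ⊤)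
  have hf : ∀ y, 0 ≤ f y := fun y => (hfr (mem_range_self y)).1
  have hρ : ∀ y, 0 ≤ ρ y := fun y => (hρr (mem_range_self y)).1
  have hfK : {y | f y = 0} = K := by
    have : (Function.support f)ᶜ = K := by rw [hfs, compl_compl]
    rw [← this]; ext y; simp
  have hρU : ∀ y, ρ y ≠ 0 ↔ y ∈ U := fun y => by rw [← hρs, Function.mem_support]
  have hρf : ∀ y, f y = 0 → 0 < ρ y := fun y hy =>
    lt_of_le_of_ne (hρ y) ((hρU y).2 (hKU (hfK ▸ hy))).symm
  have hpos : ∀ p : ℝ × Y, 0 < stretchDenom f p ↔ p ∈ (Ici (0 : ℝ) ×ˢ K)ᶜ := fun p => by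
    rw [stretchDenom_pos_iff hf, hfK]; rfl
  choose G hG using fun p : ℝ × Y => exists_stretch_eq hδ hρ hf hρf p.1 p.2
  have hg : ContDiff ℝ (⊤ : ℕ∞) expNegInvGlue := expNegInvGlue.contDiff
  have hDC : ContDiff ℝ (⊤ : ℕ∞) (stretchDenom f : ℝ × Y → ℝ) :=
    (hg.comp contDiff_fst.neg).add (hfC.comp contDiff_snd)
  have hφC : ContDiffOn ℝ (⊤ : ℕ∞) (stretch δ ρ f) (Ici (0 : ℝ) ×ˢ K)ᶜ :=
    contDiffOn_fst.add (((hρC.comp contDiff_snd).mul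
      (hg.comp (contDiff_fst.add contDiff_const))).contDiffOn.div hDC.contDiffOn
        fun p hp => ((hpos p).2 hp).ne')
  have hW : IsOpen (Ici (0 : ℝ) ×ˢ K)ᶜ := (isClosed_Ici.prod hK).isOpen_compl
  have hGφ : ∀ p ∈ (Ici (0 : ℝ) ×ˢ K)ᶜ, G (stretch δ ρ f p, p.2) = p.1 := fun p hp =>
    stretch_injective_fiber hρ (hG _).1 ((hpos p).2 hp) (hG (stretch δ ρ f p, p.2)).2
  refine ⟨stretch δ ρ f, G, hφC, ?_, fun p => (hpos _).1 (hG p).1, hGφ, fun p => (hG p).2, ?_⟩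
  · have := FiniteDimensional.complete ℝ Y
    refine contDiff_fiberwise_inverse hW hφC ?_ (fun p => (hpos _).1 (hG p).1)
      (fun p => (hG p).2) hGφ
    intro p hp
    have hD : 0 < stretchDenom f (p.1, p.2) := (hpos p).2 hp
    obtain ⟨c, hc1, hc⟩ := exists_hasDerivAt_stretch (δ := δ) hρ hD
    have hd : HasFDerivAt (stretch δ ρ f) (fderiv ℝ (stretch δ ρ f) p) p :=
      ((hφC.contDiffAt (hW.mem_nhds hp)).differentiableAt (by simp)).hasFDerivAt
    have hline : HasDerivAt (fun s : ℝ => (s, p.2)) ((1 : ℝ), (0 : Y)) p.1 :=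
      (hasDerivAt_id p.1).prodMk (hasDerivAt_const _ _)
    have h := hd.comp_hasDerivAt (f := fun s : ℝ => (s, p.2)) p.1 hline
    rw [h.unique hc]
    linarith
  · rintro p (hp | hp)
    · exact stretch_eq_of_weight_eq_zero (not_not.1 (mt (hρU p.2).1 hp))
    · exact stretch_eq_of_le hp

/-- The neighbourhood of `1` in `ℂ` given by a sector around the positive real axis. -/
theorem isOpen_sector (θ : ℝ) : IsOpen (Complex.slitPlane ∩ {z : ℂ | |z.arg| < θ}) :=
  ContinuousOn.isOpen_inter_preimage (f := fun z : ℂ => |z.arg|)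
    (fun _ hz => (Complex.continuousAt_arg hz).abs.continuousWithinAt)
    Complex.isOpen_slitPlane isOpen_Iio

theorem eucDist3_max_lt {δ t : ℝ} {u s : ℝ × ℝ} (ht : -δ < t) (hus : dist u s < δ) :
    eucDist3 (t, u) (max t 0, s) < 2 * δ := by
  have hδ : 0 < δ := dist_nonneg.trans_lt hus
  rw [Prod.dist_eq, max_lt_iff, Real.dist_eq, Real.dist_eq] at hus
  have h1 : |t - max t 0| < δ := by
    rcases le_total t 0 with h | h
    · rw [max_eq_right h, sub_zero, abs_of_nonpos h]; linarith
    · rw [max_eq_left h, sub_self, abs_zero]; exact hδ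
  have e1 := sq_lt_sq' (abs_lt.1 h1).1 (abs_lt.1 h1).2
  have e2 := sq_lt_sq' (abs_lt.1 hus.1).1 (abs_lt.1 hus.1).2
  have e3 := sq_lt_sq' (abs_lt.1 hus.2).1 (abs_lt.1 hus.2).2
  rw [eucDist3, Real.sqrt_lt' (by linarith)]
  simp only
  nlinarith

theorem contMDiff_circle_coe :
    ContMDiff (𝓡 1) 𝓘(ℝ, ℂ) (⊤ : ℕ∞) (fun z : Circle => (z : ℂ)) := by
  have : Fact (Module.finrank ℝ ℂ = 1 + 1) := finrank_real_complex_fact'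
  exact contMDiff_coe_sphere

/-- Let `S ⊆ ℝ²` be closed and
`C = {(t, u, ζ) : t ≥ 0, u ∈ S, ζ = 1} ⊆ ℝ × ℝ² × Circle`.  For every `ε > 0` there is a
diffeomorphism `χ` from `(ℝ × ℝ² × Circle) ∖ C` onto `ℝ × ℝ² × Circle` (a smooth bijection
with smooth inverse `χ'`) of the form `χ(t, u, ζ) = (χ₁(t, u, ζ), u, ζ)`, which is the
identity at every point whose `(t, u)`-part has Euclidean distance at least `ε` from
`[0, ∞) × S`, or whose circle coordinate lies outside the arc `{e^{2πis} : |s| < ε}`. -/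
theorem exists_fiber_preserving_diffeo_removing_coisotropic
    (S : Set (ℝ × ℝ)) (hS : IsClosed S) (ε : ℝ) (hε : 0 < ε) :
    ∃ χ χ' : (ℝ × ℝ × ℝ) × Circle → (ℝ × ℝ × ℝ) × Circle,
      ContMDiffOn Imod Imod (⊤ : ℕ∞) χ (liftC S)ᶜ ∧
      ContMDiff Imod Imod (⊤ : ℕ∞) χ' ∧
      (∀ p : (ℝ × ℝ × ℝ) × Circle, χ' p ∈ (liftC S)ᶜ) ∧
      (∀ p ∈ (liftC S)ᶜ, χ' (χ p) = p) ∧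
      (∀ p : (ℝ × ℝ × ℝ) × Circle, χ (χ' p) = p) ∧
      (∀ p ∈ (liftC S)ᶜ, (χ p).1.2 = p.1.2 ∧ (χ p).2 = p.2) ∧
      (∀ p ∈ (liftC S)ᶜ,
        ((∀ q ∈ Set.Ici (0 : ℝ) ×ˢ S, ε ≤ eucDist3 p.1 q) ∨
          (∀ s : ℝ, |s| < ε → p.2 ≠ Circle.exp (2 * Real.pi * s))) →
        χ p = p) := by
  set K : Set ((ℝ × ℝ) × ℂ) := S ×ˢ {1} with hKdef
  set U : Set ((ℝ × ℝ) × ℂ) := Metric.thickening (ε / 2) S ×ˢ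
    (Complex.slitPlane ∩ {z : ℂ | |z.arg| < 2 * Real.pi * ε}) with hUdef
  have hK : IsClosed K := hS.prod isClosed_singleton
  have hU : IsOpen U := Metric.isOpen_thickening.prod (isOpen_sector _)
  have hKU : K ⊆ U := by
    refine prod_mono (Metric.self_subset_thickening (by linarith) S) ?_
    rintro z rfl
    exact ⟨Complex.one_mem_slitPlane, by simpa using by positivity⟩
  obtain ⟨φ, G, hφ, hG, hGK, hGφ, hφG, hid⟩ :=
    exists_fiberwise_diffeo_removing_halfline hK hU hKU (half_pos hε)
  set j : (ℝ × ℝ × ℝ) × Circle → ℝ × ((ℝ × ℝ) × ℂ) := fun p => (p.1.1, (p.1.2, (p.2 : ℂ)))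
    with hj
  have hmem : ∀ p : (ℝ × ℝ × ℝ) × Circle,
      p ∈ (liftC S)ᶜ ↔ j p ∈ (Ici (0 : ℝ) ×ˢ K)ᶜ := by
    intro p
    simp [liftC, hj, hKdef, Circle.ext_iff]
  have hfst : ContMDiff Imod 𝓘(ℝ, ℝ × ℝ × ℝ) (⊤ : ℕ∞)
      (Prod.fst : (ℝ × ℝ × ℝ) × Circle → ℝ × ℝ × ℝ) := contMDiff_fst
  have hsnd : ContMDiff Imod (𝓡 1) (⊤ : ℕ∞)
      (Prod.snd : (ℝ × ℝ × ℝ) × Circle → Circle) := contMDiff_snd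
  have hu : ContMDiff Imod 𝓘(ℝ, ℝ × ℝ) (⊤ : ℕ∞)
      (fun p : (ℝ × ℝ × ℝ) × Circle => p.1.2) :=
    (contDiff_snd (n := (⊤ : ℕ∞)) (𝕜 := ℝ) (E := ℝ) (F := ℝ × ℝ)).contMDiff.comp hfst
  have hjC : ContMDiff Imod 𝓘(ℝ, ℝ × ((ℝ × ℝ) × ℂ)) (⊤ : ℕ∞) j :=
    ((contDiff_fst (n := (⊤ : ℕ∞)) (𝕜 := ℝ) (E := ℝ) (F := ℝ × ℝ)).contMDiff.comp
      hfst).prodMk_space (hu.prodMk_space (contMDiff_circle_coe.comp hsnd))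
  refine ⟨fun p => ((φ (j p), p.1.2), p.2), fun p => ((G (j p), p.1.2), p.2), ?_, ?_, ?_, ?_, ?_,
    fun p _ => ⟨rfl, rfl⟩, ?_⟩
  · have h1 : ContMDiffOn Imod 𝓘(ℝ, ℝ) (⊤ : ℕ∞) (fun p => φ (j p)) (liftC S)ᶜ :=
      hφ.contMDiffOn.comp hjC.contMDiffOn fun p hp => (hmem p).1 hp
    exact (h1.prodMk_space hu.contMDiffOn).prodMk hsnd.contMDiffOn
  · exact ((hG.contMDiff.comp hjC).prodMk_space hu).prodMk hsnd
  · exact fun p => (hmem _).2 (hGK (j p))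
  · intro p hp
    exact Prod.ext (Prod.ext (hGφ (j p) ((hmem p).1 hp)) rfl) rfl
  · intro p
    exact Prod.ext (Prod.ext (hφG (j p)) rfl) rfl
  · intro p _ h
    refine Prod.ext (Prod.ext (hid (j p) ?_) rfl) rfl
    by_contra! hcon
    obtain ⟨⟨hpS, -, harg⟩, ht⟩ := hcon
    rcases h with h | h
    · obtain ⟨s, hs, hus⟩ := Metric.mem_thickening_iff.1 hpS
      have := eucDist3_max_lt ht hus
      have := h (max p.1.1 0, s) ⟨mem_Ici.2 (le_max_right _ _), hs⟩
      simp only [hj] at *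
      linarith
    · have hpi := Real.pi_pos
      refine h ((p.2 : ℂ).arg / (2 * Real.pi)) ?_ ?_
      · rw [abs_div, abs_of_pos (by positivity : 0 < 2 * Real.pi), div_lt_iff₀ (by positivity)]
        have harg : |(p.2 : ℂ).arg| < 2 * Real.pi * ε := harg
        linarith
      · rw [mul_div_cancel₀ _ (by positivity), Circle.exp_arg]
end
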